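/- arXiv:1308.4341 — 3 statements merged into one kernel-verified Lean document; each statement's English description precedes it below -/
import Mathlib

section
/- Let k ≥ 1, n ≥ 2^{4k+4}, and let G be a simple graph of order n. If μ(G) ≥ μ(S_{n,k}^+), then G contains a path on 2k+3 vertices as a subgraph, unless G is isomorphic to S_{n,k}^+. -/
open Matrix BigOperators

noncomputable def edgeCount {V : Type*} (G : SimpleGraph V) : ℕ := Nat.card G.edgeSet

noncomputable def deg {V : Type*} (G : SimpleGraph V) (v : V) : ℕ := Nat.card (G.neighborSet v)

def HasPathOn {V : Type*} (G : SimpleGraph V) (l : ℕ) : Prop :=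
  ∃ (u v : V) (p : G.Walk u v), p.IsPath ∧ p.support.length = l

noncomputable def signlessLaplacian {V : Type*} [Fintype V] [DecidableEq V]
    (G : SimpleGraph V) : Matrix V V ℝ :=
  letI : DecidableRel G.Adj := Classical.decRel _
  Matrix.diagonal (fun v => (deg G v : ℝ)) + G.adjMatrix ℝ

theorem signlessLaplacian_isHermitian {V : Type*} [Fintype V] [DecidableEq V]
    (G : SimpleGraph V) : (signlessLaplacian G).IsHermitian := by
  letI : DecidableRel G.Adj := Classical.decRel _
  unfold signlessLaplacian
  refine (Matrix.isHermitian_diagonal _).add ?_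
  rw [Matrix.IsHermitian, Matrix.conjTranspose_eq_transpose_of_trivial]
  exact G.isSymm_adjMatrix

/-- The `Q`-index of a graph: the largest eigenvalue of its signless Laplacian. -/
noncomputable def qIndex {V : Type*} [Fintype V] [DecidableEq V] (G : SimpleGraph V) : ℝ :=
  ⨆ v, (signlessLaplacian_isHermitian G).eigenvalues v

noncomputable def adjMat {V : Type*} [Fintype V] (G : SimpleGraph V) : Matrix V V ℝ :=
  letI : DecidableRel G.Adj := Classical.decRel _
  G.adjMatrix ℝ

theorem adjMat_isHermitian {V : Type*} [Fintype V] (G : SimpleGraph V) :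
    (adjMat G).IsHermitian := by
  letI : DecidableRel G.Adj := Classical.decRel _
  unfold adjMat
  rw [Matrix.IsHermitian, Matrix.conjTranspose_eq_transpose_of_trivial]
  exact G.isSymm_adjMatrix

/-- The spectral radius `μ`: the largest eigenvalue of the adjacency matrix. -/
noncomputable def muIndex {V : Type*} [Fintype V] [DecidableEq V] (G : SimpleGraph V) : ℝ :=
  ⨆ v, (adjMat_isHermitian G).eigenvalues v

/-- `S_{n,k} = K_k ∨ \overline{K_{n-k}}`: the first `k` vertices form a clique joined to all. -/
def Snk (n k : ℕ) : SimpleGraph (Fin n) :=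
  SimpleGraph.fromRel (fun i j => (i : ℕ) < k ∨ (j : ℕ) < k)

/-- `S_{n,k}^+`: `S_{n,k}` plus one edge inside the independent set. -/
def SnkPlus (n k : ℕ) : SimpleGraph (Fin n) :=
  SimpleGraph.fromRel (fun i j => (i : ℕ) < k ∨ (j : ℕ) < k ∨ ((i : ℕ) = k ∧ (j : ℕ) = k + 1))

/-- `L_{t,k} = K_1 ∨ tK_k`: `t` cliques of order `k+1` sharing a common center `none`. -/
def LGraph (t k : ℕ) : SimpleGraph (Option (Fin t × Fin k)) :=
  SimpleGraph.fromRel (fun x y => x = none ∨ ∃ i a b, x = some (i, a) ∧ y = some (i, b))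

/-- `K_1 ∨ (sK_k ∪ K_m)`. -/
def K1JoinCliques (s k m : ℕ) : SimpleGraph (Option ((Fin s × Fin k) ⊕ Fin m)) :=
  SimpleGraph.fromRel (fun x y => x = none ∨
    (∃ i a b, x = some (Sum.inl (i, a)) ∧ y = some (Sum.inl (i, b))) ∨
    (∃ a b, x = some (Sum.inr a) ∧ y = some (Sum.inr b)))

/-- Two disjoint copies of `L_{s,k}` and `L_{t,k}` with their centers joined by an edge. -/
def DoubleL (s t k : ℕ) : SimpleGraph (Option (Fin s × Fin k) ⊕ Option (Fin t × Fin k)) :=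
  SimpleGraph.fromRel (fun x y =>
    (∃ a b, x = Sum.inl a ∧ y = Sum.inl b ∧ (LGraph s k).Adj a b) ∨
    (∃ a b, x = Sum.inr a ∧ y = Sum.inr b ∧ (LGraph t k).Adj a b) ∨
    (x = Sum.inl none ∧ y = Sum.inr none))

/-- `G` is (a copy of) a subgraph of `H`. -/
def IsSubgraphOf {V W : Type*} (G : SimpleGraph V) (H : SimpleGraph W) : Prop :=
  ∃ f : V ↪ W, ∀ a b, G.Adj a b → H.Adj (f a) (f b)

/-- `G` contains `m` pairwise disjoint edges. -/
def HasMatching {V : Type*} (G : SimpleGraph V) (m : ℕ) : Prop :=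
  ∃ M : Finset (Sym2 V), M.card = m ∧ (∀ e ∈ M, e ∈ G.edgeSet) ∧
    ∀ e ∈ M, ∀ f ∈ M, e ≠ f → ∀ v : V, ¬(v ∈ e ∧ v ∈ f)

/-- `G` is 2-connected: at least 3 vertices, and deleting any vertex leaves a connected graph. -/
def TwoConnected {V : Type*} [Fintype V] (G : SimpleGraph V) : Prop :=
  3 ≤ Fintype.card V ∧ ∀ v : V, (G.induce {w : V | w ≠ v}).Connected

section Spectral

theorem adjMat_mulVec_apply {V : Type*} [Fintype V] (G : SimpleGraph V) [DecidableRel G.Adj]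
    (y : V → ℝ) (v : V) : (adjMat G *ᵥ y) v = ∑ w with G.Adj v w, y w := by
  have h : adjMat G = G.adjMatrix ℝ := by
    unfold adjMat
    congr!
  simp only [h, mulVec, dotProduct, SimpleGraph.adjMatrix_apply, ite_mul, one_mul, zero_mul,
    Finset.sum_filter]

variable {V : Type*} [Fintype V] [DecidableEq V]

theorem posSemidef_muIndex_sub_adjMat (G : SimpleGraph V) :
    (algebraMap ℝ (Matrix V V ℝ) (muIndex G) - adjMat G).PosSemidef := by
  have hA := adjMat_isHermitian G
  have hc : (algebraMap ℝ (Matrix V V ℝ) (muIndex G)).IsHermitian := by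
    rw [Algebra.algebraMap_eq_smul_one, Matrix.IsHermitian]
    simp
  have hM := hc.sub hA
  rw [hM.posSemidef_iff_eigenvalues_nonneg]
  intro i
  have hi : hM.eigenvalues i ∈ spectrum ℝ (algebraMap ℝ (Matrix V V ℝ) (muIndex G) - adjMat G) :=
    hM.eigenvalues_mem_spectrum_real i
  rw [← spectrum.singleton_sub_eq, hA.spectrum_real_eq_range_eigenvalues] at hi
  obtain ⟨a, ha, b, ⟨j, rfl⟩, hab⟩ := hi
  rw [Set.mem_singleton_iff] at ha
  subst ha
  simp only [Pi.zero_apply]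
  rw [← hab]
  exact sub_nonneg.2 (le_ciSup (Set.finite_range _).bddAbove j)

theorem dotProduct_adjMat_mulVec_le (G : SimpleGraph V) (y : V → ℝ) :
    y ⬝ᵥ adjMat G *ᵥ y ≤ muIndex G * (y ⬝ᵥ y) := by
  have h := (posSemidef_muIndex_sub_adjMat G).dotProduct_mulVec_nonneg y
  simpa [sub_mulVec, Algebra.algebraMap_eq_smul_one, smul_mulVec, dotProduct_sub] using h

theorem exists_mulVec_eq_muIndex_smul [Nonempty V] (G : SimpleGraph V) :
    ∃ y : V → ℝ, y ≠ 0 ∧ adjMat G *ᵥ y = muIndex G • y := by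
  have hA := adjMat_isHermitian G
  obtain ⟨i, hi⟩ := exists_eq_ciSup_of_finite (f := (adjMat_isHermitian G).eigenvalues)
  refine ⟨_, ?_, (hA.mulVec_eigenvectorBasis i).trans (by rw [hi]; rfl)⟩
  intro h
  exact hA.eigenvectorBasis.orthonormal.ne_zero i (WithLp.ofLp_injective 2 h)

/-- A Perron vector of `G`, normalized to have maximum entry `1`. -/
theorem exists_perron_vector [Nonempty V] (G : SimpleGraph V) [DecidableRel G.Adj] :
    ∃ x : V → ℝ, (∀ v, 0 ≤ x v) ∧ (∀ v, x v ≤ 1) ∧ (∃ u, x u = 1) ∧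
      ∀ v, muIndex G * x v = ∑ w with G.Adj v w, x w := by
  obtain ⟨y, hy0, hy⟩ := exists_mulVec_eq_muIndex_smul G
  have hle : y ⬝ᵥ adjMat G *ᵥ y ≤ |y| ⬝ᵥ adjMat G *ᵥ |y| := by
    simp only [dotProduct, adjMat_mulVec_apply, Finset.mul_sum, Pi.abs_apply]
    refine Finset.sum_le_sum fun v _ => Finset.sum_le_sum fun w _ => ?_
    rw [← abs_mul]
    exact le_abs_self _
  have hsq : |y| ⬝ᵥ |y| = y ⬝ᵥ y := by
    simp [dotProduct]
  have hmax : |y| ⬝ᵥ adjMat G *ᵥ |y| = muIndex G * (|y| ⬝ᵥ |y|) := by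
    apply le_antisymm (dotProduct_adjMat_mulVec_le G _)
    rw [hsq]
    calc muIndex G * (y ⬝ᵥ y) = y ⬝ᵥ adjMat G *ᵥ y := by
          rw [hy, dotProduct_smul, smul_eq_mul]
      _ ≤ _ := hle
  have hz := ((posSemidef_muIndex_sub_adjMat G).dotProduct_mulVec_zero_iff |y|).1 (by
    simp [sub_mulVec, Algebra.algebraMap_eq_smul_one, smul_mulVec, dotProduct_sub, hmax])
  have hev : ∀ v, muIndex G * |y v| = ∑ w with G.Adj v w, |y w| := by
    intro v
    have := congrFun hz v
    rw [sub_mulVec, Pi.sub_apply, adjMat_mulVec_apply] at this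
    simpa [Algebra.algebraMap_eq_smul_one, smul_mulVec, sub_eq_zero] using this
  obtain ⟨u, hu⟩ := Finite.exists_max fun v => |y v|
  obtain ⟨w, hw⟩ := Function.ne_iff.1 hy0
  have hpos : 0 < |y u| := (abs_pos.2 hw).trans_le (hu w)
  refine ⟨fun v => |y v| / |y u|, fun v => by positivity, fun v => (div_le_one hpos).2 (hu v),
    ⟨u, div_self hpos.ne'⟩, fun v => ?_⟩
  rw [← Finset.sum_div, ← hev, mul_div_assoc]

end Spectral

section Paths

variable {V : Type*} {G : SimpleGraph V}

theorem hasPathOn_of_isChain {l : List V} (hne : l ≠ []) (hc : l.IsChain G.Adj) (hn : l.Nodup) :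
    HasPathOn G l.length :=
  ⟨_, _, SimpleGraph.Walk.ofSupport l hne hc, by
    rw [SimpleGraph.Walk.isPath_def, SimpleGraph.Walk.support_ofSupport]; exact hn, by
    rw [SimpleGraph.Walk.support_ofSupport]⟩

variable [DecidableEq V] [DecidableRel G.Adj]

/-- A graph without a path on `q + 2` vertices is `q`-degenerate. -/
theorem exists_card_filter_adj_le {q : ℕ} (hG : ¬HasPathOn G (q + 2)) {U : Finset V}
    (hU : U.Nonempty) : ∃ v ∈ U, (U.filter (G.Adj v)).card ≤ q := by
  by_contra! h
  have key : ∀ m ≤ q + 1, ∃ v l, (v :: l).IsChain G.Adj ∧ (v :: l).Nodup ∧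
      (∀ w ∈ v :: l, w ∈ U) ∧ (v :: l).length = m + 1 := by
    intro m hm
    induction m with
    | zero =>
      obtain ⟨v, hv⟩ := hU
      exact ⟨v, [], by simp, by simp, by simpa using hv, by simp⟩
    | succ m ih =>
      obtain ⟨v, l, hc, hn, hU', hl⟩ := ih (by omega)
      have hlt : l.toFinset.card < (U.filter (G.Adj v)).card := by
        have := h v (hU' v (by simp))
        have := l.toFinset_card_le
        simp only [List.length_cons] at hl
        omega
      obtain ⟨w, hw, hwl⟩ := Finset.exists_mem_notMem_of_card_lt_card hlt
      rw [Finset.mem_filter] at hw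
      rw [List.mem_toFinset] at hwl
      refine ⟨w, v :: l, ?_, ?_, ?_, by simpa using hl⟩
      · rw [List.isChain_cons_cons]
        exact ⟨hw.2.symm, hc⟩
      · rw [List.nodup_cons]
        refine ⟨?_, hn⟩
        simp only [List.mem_cons, not_or]
        exact ⟨hw.2.ne', hwl⟩
      · intro a ha
        rcases List.mem_cons.1 ha with rfl | ha
        · exact hw.1
        · exact hU' a ha
  obtain ⟨v, l, hc, hn, -, hl⟩ := key (q + 1) le_rfl
  exact hG (hl ▸ hasPathOn_of_isChain (by simp) hc hn)

/-- In a graph without a path on `q + 2` vertices, the bilinear form of the adjacency matrix is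
small at vectors with entries in `[0, 1]`. -/
theorem sum_sum_adj_le {q : ℕ} (hG : ¬HasPathOn G (q + 2)) {f g : V → ℝ}
    (hf : ∀ v, 0 ≤ f v) (hf' : ∀ v, f v ≤ 1) (hg : ∀ v, 0 ≤ g v) (hg' : ∀ v, g v ≤ 1)
    (U : Finset V) :
    ∑ v ∈ U, ∑ w ∈ U, (if G.Adj v w then f v * g w else 0) ≤
      q * ∑ v ∈ U, f v + q * ∑ v ∈ U, g v := by
  induction hm : U.card generalizing U with
  | zero =>
    rw [Finset.card_eq_zero] at hm
    simp [hm]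
  | succ m ih =>
    obtain ⟨v, hv, hq⟩ := exists_card_filter_adj_le hG (Finset.card_pos.1 (by omega : 0 < U.card))
    have hbound : ∀ {h : V → ℝ}, (∀ v, h v ≤ 1) →
        ∑ w ∈ U.erase v, (if G.Adj v w then h w else 0) ≤ q := by
      intro h hh
      rw [← Finset.sum_filter]
      calc ∑ w ∈ (U.erase v).filter (G.Adj v), h w
          ≤ ((U.erase v).filter (G.Adj v)).card • (1 : ℝ) :=
            Finset.sum_le_card_nsmul _ _ _ fun w _ => hh w
        _ ≤ q := by
            rw [nsmul_one]
            exact_mod_cast (Finset.card_le_card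
              (Finset.filter_subset_filter _ (Finset.erase_subset _ _))).trans hq
    have ih' := ih (U.erase v) (by rw [Finset.card_erase_of_mem hv]; omega)
    have h1 : ∑ w ∈ U.erase v, (if G.Adj v w then f v * g w else 0) ≤ f v * q := by
      simp only [← mul_ite_zero, ← Finset.mul_sum]
      exact mul_le_mul_of_nonneg_left (hbound hg') (hf v)
    have h2 : ∑ w ∈ U.erase v, (if G.Adj w v then f w * g v else 0) ≤ g v * q := by
      simp only [← ite_zero_mul, ← Finset.sum_mul, G.adj_comm _ v]
      rw [mul_comm]
      exact mul_le_mul_of_nonneg_left (hbound hf') (hg v)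
    simp only [← Finset.sum_erase_add _ _ hv, Finset.sum_add_distrib, G.irrefl, if_false]
    linarith

end Paths

section LowerBound

theorem snkPlus_adj {n k : ℕ} {i j : Fin n} :
    (SnkPlus n k).Adj i j ↔ (i : ℕ) ≠ j ∧ ((i : ℕ) < k ∨ (j : ℕ) < k ∨
      ((i : ℕ) = k ∧ (j : ℕ) = k + 1) ∨ ((i : ℕ) = k + 1 ∧ (j : ℕ) = k)) := by
  rw [SnkPlus, SimpleGraph.fromRel_adj, Ne, Fin.ext_iff]
  grind

/-- A subsolution of the eigenvalue equation of `S_{n,k}^+` at `t`. -/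
noncomputable def snkPlusTest (k : ℕ) (t : ℝ) (i : ℕ) : ℝ :=
  if i < k then 1 else if i < k + 2 then k / (t - 1) else k / t

theorem sum_range_snkPlusTest (k m : ℕ) (t : ℝ) :
    ∑ i ∈ Finset.range (k + 2 + m), snkPlusTest k t i =
      k + 2 * (k / (t - 1)) + m * (k / t) := by
  have h1 : ∑ i ∈ Finset.range k, snkPlusTest k t i = k := by
    rw [Finset.sum_congr rfl (g := fun _ => (1 : ℝ)) fun i hi => by
      rw [snkPlusTest, if_pos (Finset.mem_range.1 hi)]]
    simp
  have h2 : ∑ i ∈ Finset.range m, snkPlusTest k t (k + 2 + i) = m * (k / t) := by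
    rw [Finset.sum_congr rfl (g := fun _ => k / t) fun i _ => by
      rw [snkPlusTest, if_neg (by omega), if_neg (by omega)]]
    simp
  rw [Finset.sum_range_add, Finset.sum_range_succ, Finset.sum_range_succ, h1, h2]
  simp [snkPlusTest]
  ring

theorem le_sum_adj_snkPlusTest {k n : ℕ} (hn : k + 2 ≤ n) {t : ℝ} (ht : 1 < t) {i : ℕ}
    (hi : ¬ i < k) :
    t * snkPlusTest k t i ≤ ∑ j ∈ Finset.range n, if i ≠ j ∧ (i < k ∨ j < k ∨
      (i = k ∧ j = k + 1) ∨ (i = k + 1 ∧ j = k)) then snkPlusTest k t j else 0 := by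
  obtain ⟨m, rfl⟩ := Nat.exists_eq_add_of_le hn
  have hnn : ∀ j, 0 ≤ snkPlusTest k t j := by
    intro j
    have : (0 : ℝ) ≤ t - 1 := by linarith
    unfold snkPlusTest
    split_ifs <;> positivity
  have h1 : ∑ j ∈ Finset.range k, (if i ≠ j ∧ (i < k ∨ j < k ∨
      (i = k ∧ j = k + 1) ∨ (i = k + 1 ∧ j = k)) then snkPlusTest k t j else 0) = k := by
    rw [Finset.sum_congr rfl (g := fun _ => (1 : ℝ)) fun j hj => by
      have := Finset.mem_range.1 hj
      rw [if_pos (by omega), snkPlusTest, if_pos this]]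
    simp
  have ht0 : t ≠ 0 := by linarith
  have ht1 : t - 1 ≠ 0 := by linarith
  rw [Finset.sum_range_add, Finset.sum_range_succ, Finset.sum_range_succ, h1]
  have h2 : 0 ≤ ∑ j ∈ Finset.range m, if i ≠ k + 2 + j ∧ (i < k ∨ k + 2 + j < k ∨
      (i = k ∧ k + 2 + j = k + 1) ∨ (i = k + 1 ∧ k + 2 + j = k))
        then snkPlusTest k t (k + 2 + j) else 0 := by
    refine Finset.sum_nonneg fun j _ => ?_
    split_ifs
    · exact hnn _
    · exact le_rfl
  refine le_add_of_le_of_nonneg ?_ h2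
  rcases (by omega : i = k ∨ i = k + 1 ∨ k + 2 ≤ i) with rfl | rfl | hi2
  · simp [snkPlusTest]
    apply le_of_eq
    field_simp
    ring
  · simp [snkPlusTest]
    apply le_of_eq
    field_simp
    ring
  · rw [if_neg (by omega), if_neg (by omega), snkPlusTest, if_neg hi, if_neg (by omega)]
    apply le_of_eq
    field_simp
    ring

theorem lt_muIndex_snkPlus {k n : ℕ} (hk : 1 ≤ k) (hn : k + 2 ≤ n) {t : ℝ} (ht : 1 < t)
    (h : t ^ 2 < (k - 1) * t + k * (n - k) + 2 * k / (t - 1)) :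
    t < muIndex (SnkPlus n k) := by
  classical
  set y : Fin n → ℝ := fun i => snkPlusTest k t i with hy
  have ht1 : 0 < t - 1 := by linarith
  have ht0 : 0 < t := by linarith
  have hypos : ∀ i, 0 < y i := by
    intro i
    have : (0 : ℝ) < k := by exact_mod_cast hk
    simp only [hy, snkPlusTest]
    split_ifs <;> positivity
  have hAy : ∀ i : Fin n, (adjMat (SnkPlus n k) *ᵥ y) i = ∑ j ∈ Finset.range n,
      if (i : ℕ) ≠ j ∧ ((i : ℕ) < k ∨ j < k ∨ ((i : ℕ) = k ∧ j = k + 1) ∨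
        ((i : ℕ) = k + 1 ∧ j = k)) then snkPlusTest k t j else 0 := by
    intro i
    rw [adjMat_mulVec_apply, Finset.sum_filter, ← Fin.sum_univ_eq_sum_range (fun j =>
      if (i : ℕ) ≠ j ∧ ((i : ℕ) < k ∨ j < k ∨ ((i : ℕ) = k ∧ j = k + 1) ∨
        ((i : ℕ) = k + 1 ∧ j = k)) then snkPlusTest k t j else 0)]
    refine Finset.sum_congr rfl fun j _ => ?_
    simp only [snkPlus_adj, hy]
  have hlow : ∀ i : Fin n, (i : ℕ) < k → t * y i < (adjMat (SnkPlus n k) *ᵥ y) i := by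
    intro i hi
    rw [hAy]
    have h1 : ∑ j ∈ Finset.range n, (if (i : ℕ) ≠ j ∧ ((i : ℕ) < k ∨ j < k ∨
        ((i : ℕ) = k ∧ j = k + 1) ∨ ((i : ℕ) = k + 1 ∧ j = k)) then snkPlusTest k t j else 0) =
        ∑ j ∈ Finset.range n, snkPlusTest k t j - 1 := by
      rw [← Finset.sum_erase_add _ _ (Finset.mem_range.2 i.2),
        ← Finset.sum_erase_add _ (snkPlusTest k t) (Finset.mem_range.2 i.2)]
      rw [Finset.sum_congr rfl (g := snkPlusTest k t) fun j hj => by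
        rw [if_pos ⟨(Finset.ne_of_mem_erase hj).symm, Or.inl hi⟩]]
      simp [snkPlusTest, hi]
    obtain ⟨m, rfl⟩ := Nat.exists_eq_add_of_le hn
    rw [h1, sum_range_snkPlusTest]
    have : y i = 1 := by simp [hy, snkPlusTest, hi]
    rw [this, mul_one]
    push_cast at h
    have e : ((k - 1) * t + k * (k + 2 + m - k) + 2 * k / (t - 1)) =
        t * (k + 2 * (k / (t - 1)) + m * (k / t) - 1) := by
      field_simp
      ring
    rw [e, pow_two] at h
    exact lt_of_mul_lt_mul_left h ht0.le
  have hle : ∀ i : Fin n, t * y i ≤ (adjMat (SnkPlus n k) *ᵥ y) i := by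
    intro i
    by_cases hi : (i : ℕ) < k
    · exact (hlow i hi).le
    · rw [hAy]
      exact le_sum_adj_snkPlusTest hn ht hi
  have hyy : 0 < y ⬝ᵥ y :=
    Finset.sum_pos (fun i _ => mul_pos (hypos i) (hypos i)) ⟨⟨0, by omega⟩, Finset.mem_univ _⟩
  have hlt : t * (y ⬝ᵥ y) < y ⬝ᵥ adjMat (SnkPlus n k) *ᵥ y := by
    simp only [dotProduct, Finset.mul_sum]
    refine Finset.sum_lt_sum (fun i _ => ?_) ⟨⟨0, by omega⟩, Finset.mem_univ _, ?_⟩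
    · rw [mul_left_comm]
      exact mul_le_mul_of_nonneg_left (hle i) (hypos i).le
    · rw [mul_left_comm]
      exact mul_lt_mul_of_pos_left (hlow _ hk) (hypos _)
  exact lt_of_mul_lt_mul_right (hlt.trans_le (dotProduct_adjMat_mulVec_le _ _)) hyy.le

end LowerBound

section Parameters

theorem sixteen_mul_le {k n : ℕ} (hn : 2 ^ (4 * k + 4) ≤ n) : 16 * (k + 1) ≤ n := by
  have h : k + 1 ≤ 16 ^ k := Nat.lt_pow_self (by norm_num)
  calc 16 * (k + 1) ≤ 16 * 16 ^ k := Nat.mul_le_mul_left _ h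
    _ = 2 ^ (4 * k + 4) := by rw [pow_add, pow_mul]; norm_num [mul_comm]
    _ ≤ n := hn

theorem two_mul_add_one_le_of_muIndex_le {k n : ℕ} (hk : 1 ≤ k) (hn : 2 ^ (4 * k + 4) ≤ n) {t : ℝ}
    (ht : muIndex (SnkPlus n k) ≤ t) : (2 * k + 1 : ℝ) ≤ t := by
  have h16 := sixteen_mul_le hn
  refine le_trans (lt_muIndex_snkPlus hk (by omega) ?_ ?_).le ht
  · have : (1 : ℝ) ≤ k := by exact_mod_cast hk
    linarith
  · have hk' : (1 : ℝ) ≤ k := by exact_mod_cast hk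
    have hn' : (16 * (k + 1) : ℝ) ≤ n := by exact_mod_cast h16
    have : (2 * k / (2 * k + 1 - 1) : ℝ) = 1 := by
      rw [add_sub_cancel_right, div_self (by positivity)]
    rw [this]
    nlinarith

theorem le_sq_of_muIndex_le {k n : ℕ} (hk : 1 ≤ k) (hn : 2 ^ (4 * k + 4) ≤ n) {t : ℝ}
    (ht : muIndex (SnkPlus n k) ≤ t) :
    (k - 1) * t + k * (n - k) + 2 * k / (t - 1) ≤ t ^ 2 := by
  by_contra! h
  have h16 := sixteen_mul_le hn
  have h1 := two_mul_add_one_le_of_muIndex_le hk hn ht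
  have hk' : (1 : ℝ) ≤ k := by exact_mod_cast hk
  exact absurd (lt_muIndex_snkPlus hk (by omega) (by linarith) h) (not_lt.2 ht)

end Parameters

section Pruning

variable {V : Type*} {G : SimpleGraph V} [DecidableEq V] [DecidableRel G.Adj]

theorem exists_alternating_chain {k : ℕ} {A B : Finset V} (hAB : Disjoint A B)
    (hA : ∀ a ∈ A, k + 1 ≤ (B.filter (G.Adj a)).card)
    (hB : ∀ b ∈ B, k ≤ (A.filter (G.Adj b)).card) (hne : B.Nonempty) {j : ℕ} (hj : j ≤ k) :
    ∃ b l, ∃ S ⊆ A, ∃ T ⊆ B, (b :: l).IsChain G.Adj ∧ (b :: l).Nodup ∧ b ∈ T ∧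
      (∀ w ∈ b :: l, w ∈ S ∪ T) ∧ S.card = j ∧ T.card = j + 1 ∧ (b :: l).length = 2 * j + 1 := by
  induction j with
  | zero =>
    obtain ⟨b, hb⟩ := hne
    exact ⟨b, [], ∅, by simp, {b}, by simpa using hb, by simp⟩
  | succ j ih =>
    obtain ⟨b, l, S, hS, T, hT, hc, hn, hbT, hmem, hSc, hTc, hl⟩ := ih (by omega)
    obtain ⟨a, ha, haS⟩ := Finset.exists_mem_notMem_of_card_lt_card
      (show S.card < (A.filter (G.Adj b)).card by have := hB b (hT hbT); omega)
    rw [Finset.mem_filter] at ha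
    obtain ⟨b', hb', hbT'⟩ := Finset.exists_mem_notMem_of_card_lt_card
      (show T.card < (B.filter (G.Adj a)).card by have := hA a ha.1; omega)
    rw [Finset.mem_filter] at hb'
    have haT : a ∉ T := fun h => Finset.disjoint_left.1 hAB ha.1 (hT h)
    have hbS' : b' ∉ S := fun h => Finset.disjoint_left.1 hAB (hS h) hb'.1
    have hbl : b' ∉ b :: l := fun h => by
      have := hmem _ h
      simp_all
    have hal : a ∉ b :: l := fun h => by
      have := hmem _ h
      simp_all
    refine ⟨b', a :: b :: l, insert a S, Finset.insert_subset ha.1 hS, insert b' T,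
      Finset.insert_subset hb'.1 hT, ?_, ?_, by simp, ?_, by simp [haS, hSc],
      by simp [hbT', hTc], ?_⟩
    · simp only [List.isChain_cons_cons] at hc ⊢
      exact ⟨hb'.2.symm, ha.2.symm, hc⟩
    · rw [List.nodup_cons, List.nodup_cons, List.mem_cons, not_or]
      exact ⟨⟨hb'.2.ne', hbl⟩, hal, hn⟩
    · intro w hw
      rw [List.mem_cons, List.mem_cons] at hw
      rcases hw with rfl | rfl | hw
      · simp
      · simp
      · have := Finset.mem_union.1 (hmem w hw)
        simp only [Finset.mem_union, Finset.mem_insert]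
        tauto
    · simp only [List.length_cons] at hl ⊢
      omega

theorem exists_common_neighbors {k : ℕ} (hk : 1 ≤ k) (hG : ¬HasPathOn G (2 * k + 3))
    {A B : Finset V} (hAB : Disjoint A B)
    (hA : ∀ a ∈ A, 2 * k + 3 ≤ (B.filter (G.Adj a)).card)
    (hB : ∀ b ∈ B, k ≤ (A.filter (G.Adj b)).card) (hne : B.Nonempty) :
    ∃ K ⊆ A, ∃ C ⊆ B, K.card = k ∧ k + 3 ≤ C.card ∧ ∀ a ∈ K, ∀ c ∈ C, G.Adj a c := by
  obtain ⟨b, l, S, hS, T, hT, hc, hn, hbT, hmem, hSc, hTc, hl⟩ :=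
    exists_alternating_chain (G := G) (k := k) hAB (fun a ha => by have := hA a ha; omega) hB hne
      (j := k - 1) (by omega)
  obtain ⟨a, ha, haS⟩ := Finset.exists_mem_notMem_of_card_lt_card
    (show S.card < (A.filter (G.Adj b)).card by have := hB b (hT hbT); omega)
  rw [Finset.mem_filter] at ha
  have haT : a ∉ T := fun h => Finset.disjoint_left.1 hAB ha.1 (hT h)
  have hal : a ∉ b :: l := fun h => by
    have := hmem _ h
    simp_all
  have hK : (insert a S).card = k := by
    rw [Finset.card_insert_of_notMem haS]
    omega
  refine ⟨insert a S, Finset.insert_subset ha.1 hS, B.filter (G.Adj a) \ T,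
    Finset.sdiff_subset.trans (Finset.filter_subset _ _), hK, ?_, ?_⟩
  · have := Finset.le_card_sdiff T (B.filter (G.Adj a))
    have := hA a ha.1
    omega
  · intro a₁ ha₁ c hc'
    rw [Finset.mem_sdiff, Finset.mem_filter] at hc'
    obtain ⟨⟨hcB, hac⟩, hcT⟩ := hc'
    have hsub : A.filter (G.Adj c) ⊆ insert a S := by
      intro a' ha'
      by_contra haK
      rw [Finset.mem_filter] at ha'
      rw [Finset.mem_insert, not_or] at haK
      obtain ⟨b', hb', hbT'⟩ := Finset.exists_mem_notMem_of_card_lt_card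
        (show (insert c T).card < (B.filter (G.Adj a')).card by
          have := hA a' ha'.1
          have := Finset.card_insert_le c T
          omega)
      rw [Finset.mem_filter] at hb'
      rw [Finset.mem_insert, not_or] at hbT'
      have hd : ∀ x ∈ A, ∀ y ∈ B, x ≠ y := fun x hx y hy hxy =>
        Finset.disjoint_left.1 hAB hx (hxy ▸ hy)
      have hout : ∀ w, w ∉ S → w ∉ T → w ∉ b :: l := fun w h1 h2 h => by
        have := hmem _ h
        simp_all
      refine hG ?_
      have hlen : (b' :: a' :: c :: a :: b :: l).length = 2 * k + 3 := by
        simp only [List.length_cons] at hl ⊢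
        omega
      rw [← hlen]
      refine hasPathOn_of_isChain (by simp) ?_ ?_
      · simp only [List.isChain_cons_cons] at hc ⊢
        exact ⟨hb'.2.symm, ha'.2.symm, hac.symm, ha.2.symm, hc⟩
      · have e1 : b' ∉ b :: l := hout _ (fun h => hd _ (hS h) _ hb'.1 rfl) hbT'.2
        have e2 : a' ∉ b :: l := hout _ haK.2 fun h => hd _ ha'.1 _ (hT h) rfl
        have e3 : c ∉ b :: l := hout _ (fun h => hd _ (hS h) _ hcB rfl) hcT
        rw [List.nodup_cons, List.nodup_cons, List.nodup_cons, List.nodup_cons]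
        refine ⟨?_, ?_, ?_, hal, hn⟩
        · rw [List.mem_cons, List.mem_cons, List.mem_cons]
          rintro (h | h | h | h)
          · exact hd _ ha'.1 _ hb'.1 h.symm
          · exact hbT'.1 h
          · exact hd _ ha.1 _ hb'.1 h.symm
          · exact e1 h
        · rw [List.mem_cons, List.mem_cons]
          rintro (h | h | h)
          · exact hd _ ha'.1 _ hcB h
          · exact haK.1 h
          · exact e2 h
        · rw [List.mem_cons]
          rintro (h | h)
          · exact hd _ ha.1 _ hcB h.symm
          · exact e3 h
    have heq := Finset.eq_of_subset_of_card_le hsub (by rw [hK]; exact hB c hcB)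
    rw [← heq, Finset.mem_filter] at ha₁
    exact ha₁.2.symm

/-- Between disjoint sets of a graph without a path on `2 * k + 3` vertices there are few edges,
unless some `k` vertices of the first set have at least `k + 3` common neighbors in the second. -/
theorem sum_sum_adj_le_of_disjoint {k : ℕ} (hk : 1 ≤ k) (hG : ¬HasPathOn G (2 * k + 3))
    {g : V → ℝ} (hg : ∀ v, 0 ≤ g v) (hg' : ∀ v, g v ≤ 1) {A B : Finset V} (hAB : Disjoint A B)
    (hno : ∀ K ⊆ A, ∀ C ⊆ B, K.card = k → (∀ a ∈ K, ∀ c ∈ C, G.Adj a c) → C.card < k + 3) :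
    ∑ a ∈ A, ∑ b ∈ B, (if G.Adj a b then g a else 0) ≤
      (k - 1) * B.card + (2 * k + 2) * ∑ a ∈ A, g a := by
  induction hm : A.card + B.card generalizing A B with
  | zero =>
    have hA : A = ∅ := Finset.card_eq_zero.1 (by omega)
    have hB : B = ∅ := Finset.card_eq_zero.1 (by omega)
    simp [hA, hB]
  | succ m ih =>
    by_cases h1 : ∃ a ∈ A, (B.filter (G.Adj a)).card < 2 * k + 3
    · obtain ⟨a, ha, hc⟩ := h1
      have := ih (A := A.erase a) (B := B) (hAB.mono_left (Finset.erase_subset _ _))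
        (fun K hK => hno K (hK.trans (Finset.erase_subset _ _)))
        (by rw [Finset.card_erase_of_mem ha]; have := Finset.card_pos.2 ⟨a, ha⟩; omega)
      have h2 : ∑ b ∈ B, (if G.Adj a b then g a else 0) ≤ (2 * k + 2) * g a := by
        rw [← Finset.sum_filter, Finset.sum_const, nsmul_eq_mul]
        refine mul_le_mul_of_nonneg_right ?_ (hg a)
        exact_mod_cast Nat.le_of_lt_succ hc
      rw [← Finset.sum_erase_add _ _ ha, ← Finset.sum_erase_add A g ha]
      linarith
    by_cases h2 : ∃ b ∈ B, (A.filter (G.Adj b)).card < k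
    · obtain ⟨b, hb, hc⟩ := h2
      have := ih (A := A) (B := B.erase b) (hAB.mono_right (Finset.erase_subset _ _))
        (fun K hK C hC => hno K hK C (hC.trans (Finset.erase_subset _ _)))
        (by rw [Finset.card_erase_of_mem hb]; have := Finset.card_pos.2 ⟨b, hb⟩; omega)
      have h2 : ∑ a ∈ A, (if G.Adj a b then g a else 0) ≤ k - 1 := by
        simp only [G.adj_comm _ b]
        rw [← Finset.sum_filter]
        calc ∑ w ∈ A.filter (G.Adj b), g w
            ≤ (A.filter (G.Adj b)).card • (1 : ℝ) :=
              Finset.sum_le_card_nsmul _ _ _ fun w _ => hg' w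
          _ ≤ k - 1 := by
              rw [nsmul_one, le_sub_iff_add_le]
              exact_mod_cast hc
      have hBc : (B.card : ℝ) = (B.erase b).card + 1 := by
        exact_mod_cast (Finset.card_erase_add_one hb).symm
      simp only [← Finset.sum_erase_add B _ hb, Finset.sum_add_distrib]
      rw [hBc]
      linarith
    push Not at h1 h2
    have hne : B.Nonempty := by
      by_contra hB
      rw [Finset.not_nonempty_iff_eq_empty] at hB
      subst hB
      obtain ⟨a, ha⟩ : A.Nonempty := Finset.card_pos.1 (by simp at hm; omega)
      have := h1 a ha
      simp at this
    obtain ⟨K, hK, C, hC, hKc, hCc, hKC⟩ := exists_common_neighbors hk hG hAB h1 h2 hne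
    exact absurd (hno K hK C hC hKc hKC) (by omega)

end Pruning

section Numerics

theorem sq_le_mul_sixteen_pow {k : ℕ} (hk : 3 ≤ k) :
    ((20 * k ^ 2 + 3) * (2 * k + 1)) ^ 2 ≤ 27 * 16 ^ (k + 1) := by
  induction k, hk using Nat.le_induction with
  | base => norm_num
  | succ k hk ih =>
    have h : (20 * (k + 1) ^ 2 + 3) * (2 * (k + 1) + 1) ≤ 4 * ((20 * k ^ 2 + 3) * (2 * k + 1)) := by
      obtain ⟨m, rfl⟩ := Nat.exists_eq_add_of_le hk
      ring_nf
      nlinarith [Nat.zero_le m]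
    calc ((20 * (k + 1) ^ 2 + 3) * (2 * (k + 1) + 1)) ^ 2
        ≤ (4 * ((20 * k ^ 2 + 3) * (2 * k + 1))) ^ 2 := Nat.pow_le_pow_left h 2
      _ = 16 * ((20 * k ^ 2 + 3) * (2 * k + 1)) ^ 2 := by ring
      _ ≤ 16 * (27 * 16 ^ (k + 1)) := Nat.mul_le_mul_left _ ih
      _ = 27 * 16 ^ (k + 1 + 1) := by ring

theorem false_of_dense_core {k n : ℕ} (hk : 2 ≤ k) (hn : 2 ^ (4 * k + 4) ≤ n) {t w s : ℝ}
    (ht0 : 0 ≤ t) (ht : k * n ≤ t ^ 2) (h1 : t ^ 2 ≤ (k - 1) * n + (k + 2) * w + 4 * k ^ 2 * s)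
    (h2 : (4 * k ^ 2 - 5 * k - 5) * w ≤ (k - 2) * n + 4 * k ^ 2)
    (h3 : (t - (2 * k + 1)) * s ≤ (2 * k + 1) * n) : False := by
  have hn0 : (0 : ℝ) ≤ n := by positivity
  rcases hk.eq_or_lt with rfl | hk3
  · have hn' : (4096 : ℝ) ≤ n := by exact_mod_cast (by simpa using hn)
    push_cast at *
    have ht90 : 90 ≤ t := by nlinarith
    have hs : s ≤ n / 17 := by
      by_contra! hs
      nlinarith
    linarith
  · have h16 : (16 : ℝ) ^ (k + 1) ≤ n := by
      have : 2 ^ (4 * k + 4) = 16 ^ (k + 1) := by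
        rw [show 4 * k + 4 = 4 * (k + 1) by ring, pow_mul]; norm_num
      rw [this] at hn
      exact_mod_cast hn
    have hP : (((20 * k ^ 2 + 3) * (2 * k + 1)) ^ 2 : ℝ) ≤ 27 * 16 ^ (k + 1) := by
      exact_mod_cast sq_le_mul_sixteen_pow hk3
    have hk' : (3 : ℝ) ≤ k := by exact_mod_cast hk3
    have hbig : (20 * k ^ 2 + 3) * (2 * k + 1) ≤ 3 * t := by
      refine le_of_sq_le_sq ?_ (by positivity)
      nlinarith
    have hks : 4 * k ^ 2 * s ≤ 3 / 5 * n := by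
      by_contra! hs
      have hs0 : 0 < s := by
        by_contra! hs0
        have : 4 * (k : ℝ) ^ 2 * s ≤ 0 := mul_nonpos_of_nonneg_of_nonpos (by positivity) hs0
        linarith
      have h4 : 20 * (k : ℝ) ^ 2 * (2 * k + 1) * s ≤ 3 * (t - (2 * k + 1)) * s :=
        mul_le_mul_of_nonneg_right (by linarith) hs0.le
      nlinarith
    have hw : (k + 2) * w ≤ n / 3 + 3 * (k + 2) := by
      have hD : (0 : ℝ) < 4 * k ^ 2 - 5 * k - 5 := by nlinarith
      have e1 : (k + 2) * (k - 2) * (n : ℝ) ≤ (4 * k ^ 2 - 5 * k - 5) * (n / 3) := by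
        nlinarith [mul_nonneg (show (0 : ℝ) ≤ k ^ 2 - 5 * k + 7 by nlinarith) hn0]
      have e2 : (k + 2) * (4 * (k : ℝ) ^ 2) ≤ (4 * k ^ 2 - 5 * k - 5) * (3 * (k + 2)) := by
        nlinarith [mul_nonneg (show (0 : ℝ) ≤ k + 2 by linarith)
          (show (0 : ℝ) ≤ 8 * k ^ 2 - 15 * k - 15 by nlinarith)]
      have e3 := mul_le_mul_of_nonneg_left h2 (show (0 : ℝ) ≤ k + 2 by linarith)
      refine le_of_mul_le_mul_left ?_ hD
      nlinarith
    have hn2 : (n : ℝ) ≤ 45 * (k + 2) := by nlinarith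
    have h183 : 183 * (2 * k + 1) ≤ (20 * (k : ℝ) ^ 2 + 3) * (2 * k + 1) :=
      mul_le_mul_of_nonneg_right (by nlinarith) (by linarith)
    nlinarith

end Numerics

section Core

theorem sum_sum_filter_adj {V : Type*} [Fintype V] {G : SimpleGraph V} [DecidableRel G.Adj]
    (N : Finset V) (x : V → ℝ) :
    ∑ v ∈ N, ∑ w with G.Adj v w, x w = ∑ w, ((N.filter (G.Adj w)).card : ℝ) * x w := by
  simp only [Finset.sum_filter]
  rw [Finset.sum_comm]
  refine Finset.sum_congr rfl fun w _ => ?_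
  simp only [G.adj_comm _ w]
  rw [← Finset.sum_filter, Finset.sum_const, nsmul_eq_mul]

variable {V : Type*} [DecidableEq V] {G : SimpleGraph V} [DecidableRel G.Adj]

/-- The weighted number of pairs `(w, v)` with `w ∈ W`, `v ∈ N` and `w` adjacent to `v`. -/
theorem sum_card_filter_mul_le {k : ℕ} (hk : 1 ≤ k) (hG : ¬HasPathOn G (2 * k + 3))
    {g : V → ℝ} (hg : ∀ v, 0 ≤ g v) (hg' : ∀ v, g v ≤ 1) (W N : Finset V)
    (hno : ∀ K ⊆ W, ∀ C : Finset V, K.card = k → (∀ a ∈ K, ∀ c ∈ C, G.Adj a c) → C.card < k + 3) :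
    ∑ w ∈ W, ((N.filter (G.Adj w)).card : ℝ) * g w ≤
      (k - 1) * N.card + (4 * k + 3) * ∑ w ∈ W, g w + (k + 2) * (N ∩ W).card := by
  have h1 := sum_sum_adj_le_of_disjoint hk hG hg hg' (A := W) (B := N \ W)
    Finset.disjoint_sdiff (fun K hK C _ => hno K hK C)
  have h2 := sum_sum_adj_le (q := 2 * k + 1) hG hg hg' (g := fun v => if v ∈ N then 1 else 0)
    (fun v => by split_ifs <;> norm_num) (fun v => by split_ifs <;> norm_num) W
  have h3 : ∑ v ∈ W, (if v ∈ N then (1 : ℝ) else 0) = (N ∩ W).card := by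
    rw [Finset.sum_ite_mem, Finset.inter_comm]
    simp
  have h4 : ((N \ W).card : ℝ) + (N ∩ W).card = N.card := by
    exact_mod_cast Finset.card_sdiff_add_card_inter N W
  have h5 : ∑ w ∈ W, ((N.filter (G.Adj w)).card : ℝ) * g w =
      ∑ a ∈ W, ∑ b ∈ N \ W, (if G.Adj a b then g a else 0) +
      ∑ v ∈ W, ∑ w ∈ W, (if G.Adj v w then g v * (if w ∈ N then 1 else 0) else 0) := by
    rw [← Finset.sum_add_distrib]
    refine Finset.sum_congr rfl fun w _ => ?_
    have e1 : ∑ b ∈ N ∩ W, (if G.Adj w b then g w else 0) =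
        ∑ b ∈ W, (if G.Adj w b then g w * (if b ∈ N then 1 else 0) else 0) := by
      rw [Finset.inter_comm, ← Finset.sum_ite_mem]
      refine Finset.sum_congr rfl fun b _ => ?_
      by_cases hb : b ∈ N <;> simp [hb]
    rw [← e1, add_comm, Finset.sum_inter_add_sum_sdiff, ← Finset.sum_filter, Finset.sum_const,
      nsmul_eq_mul]
  rw [h3] at h2
  push_cast at h2
  rw [h5]
  nlinarith

variable [Fintype V]

/-- A graph with large spectral radius and without a path on `2 * k + 3` vertices contains
`k` vertices with at least `k + 3` common neighbors. -/
theorem exists_complete_bipartite {k n : ℕ} (hk : 1 ≤ k) (hn : 2 ^ (4 * k + 4) ≤ n)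
    (hV : Fintype.card V = n) (hG : ¬HasPathOn G (2 * k + 3)) {t : ℝ} {x : V → ℝ}
    (hx0 : ∀ v, 0 ≤ x v) (hx1 : ∀ v, x v ≤ 1) {u : V} (hu : x u = 1)
    (hev : ∀ v, t * x v = ∑ w with G.Adj v w, x w) (ht1 : 2 * k + 1 ≤ t)
    (ht2 : (k - 1) * t + k * (n - k) + 2 * k / (t - 1) ≤ t ^ 2) :
    ∃ K C : Finset V, K.card = k ∧ (∀ a ∈ K, 0 < x a) ∧ k + 3 ≤ C.card ∧
      ∀ a ∈ K, ∀ c ∈ C, G.Adj a c := by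
  have hn16 := sixteen_mul_le hn
  have hkR : (1 : ℝ) ≤ k := by exact_mod_cast hk
  have hnR : (16 * (k + 1) : ℝ) ≤ n := by exact_mod_cast hn16
  have hfrac : 0 ≤ 2 * k / (t - 1) := div_nonneg (by positivity) (by linarith)
  set N : Finset V := Finset.univ.filter (G.Adj u) with hN
  have htN : t ≤ N.card := by
    calc t = ∑ w ∈ N, x w := by rw [← hev, hu, mul_one]
      _ ≤ N.card • (1 : ℝ) := Finset.sum_le_card_nsmul _ _ _ fun w _ => hx1 w
      _ = N.card := by rw [nsmul_one]
  rcases hk.eq_or_lt with rfl | hk2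
  · refine ⟨{u}, N, by simp, by simp [hu], ?_, ?_⟩
    · push_cast at *
      have : (3 : ℝ) < N.card := by nlinarith
      have : 3 < N.card := by exact_mod_cast this
      omega
    · intro a ha c hc
      rw [Finset.mem_singleton] at ha
      subst ha
      exact (Finset.mem_filter.1 hc).2
  by_contra! hno
  have hk2R : (2 : ℝ) ≤ k := by exact_mod_cast hk2
  have htn : k * n ≤ t ^ 2 := by nlinarith
  set W : Finset V := Finset.univ.filter
    (fun w => 4 * k ^ 2 ≤ (N.filter (G.Adj w)).card ∧ 0 < x w) with hW
  have hno' : ∀ K ⊆ W, ∀ C : Finset V, K.card = k → (∀ a ∈ K, ∀ c ∈ C, G.Adj a c) →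
      C.card < k + 3 := by
    intro K hK C hKc hKC
    by_contra! hC
    obtain ⟨a, ha, c, hc, hac⟩ := hno K C hKc (fun a ha => (Finset.mem_filter.1 (hK ha)).2.2) hC
    exact hac (hKC a ha c hc)
  have hJ : ((N ∩ W).card : ℝ) ≤ W.card := by
    exact_mod_cast Finset.card_le_card Finset.inter_subset_right
  have hNn : (N.card : ℝ) ≤ n := by
    rw [← hV]
    exact_mod_cast Finset.card_le_univ N
  have hCk : (4 * k + 3 : ℝ) ≤ 4 * k ^ 2 := by nlinarith
  refine false_of_dense_core hk2 hn (t := t) (w := W.card) (s := ∑ v, x v) (by linarith) htn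
    ?_ ?_ ?_
  · have h1 : t ^ 2 = ∑ w, ((N.filter (G.Adj w)).card : ℝ) * x w := by
      rw [← sum_sum_filter_adj]
      simp only [← hev]
      rw [← Finset.mul_sum, ← hev, hu]
      ring
    have h2 := sum_card_filter_mul_le hk hG hx0 hx1 W N hno'
    have h3 : ∑ w ∈ Wᶜ, ((N.filter (G.Adj w)).card : ℝ) * x w ≤ 4 * k ^ 2 * ∑ w ∈ Wᶜ, x w := by
      rw [Finset.mul_sum]
      refine Finset.sum_le_sum fun w hw => ?_
      have : ¬(4 * k ^ 2 ≤ (N.filter (G.Adj w)).card ∧ 0 < x w) := by simpa [hW] using hw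
      by_cases hxw : 0 < x w
      · refine mul_le_mul_of_nonneg_right ?_ hxw.le
        have : (N.filter (G.Adj w)).card ≤ 4 * k ^ 2 := by
          by_contra! h
          exact this ⟨h.le, hxw⟩
        exact_mod_cast this
      · have : x w = 0 := le_antisymm (not_lt.1 hxw) (hx0 w)
        simp [this]
    have h4 : 0 ≤ ∑ w ∈ W, x w := Finset.sum_nonneg fun w _ => hx0 w
    rw [h1, ← Finset.sum_add_sum_compl W, ← Finset.sum_add_sum_compl W x]
    nlinarith
  · have h2 := sum_card_filter_mul_le hk hG (g := fun _ => (1 : ℝ)) (by simp) (by simp) W N hno'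
    have hNu : N.filter (G.Adj u) = N := by
      rw [hN, Finset.filter_filter]
      simp
    have huW : u ∈ W := by
      rw [hW, Finset.mem_filter, hNu]
      refine ⟨Finset.mem_univ _, ?_, by rw [hu]; norm_num⟩
      have h16 : (4 * k ^ 2 : ℝ) ≤ t := by
        refine le_of_sq_le_sq ?_ (by linarith)
        have h4 : (k : ℝ) ^ 3 * 16 ≤ n := by
          have : k ^ 3 * 16 ≤ n := by
            calc k ^ 3 * 16 ≤ (2 ^ k) ^ 3 * 16 :=
                  Nat.mul_le_mul_right _ (Nat.pow_le_pow_left Nat.lt_two_pow_self.le 3)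
              _ = 2 ^ (3 * k + 4) := by ring
              _ ≤ 2 ^ (4 * k + 4) := Nat.pow_le_pow_right (by norm_num) (by omega)
              _ ≤ n := hn
          exact_mod_cast this
        nlinarith
      have := h16.trans htN
      exact_mod_cast this
    have h5 : ∑ w ∈ W, ((N.filter (G.Adj w)).card : ℝ) * 1 ≥
        4 * k ^ 2 * (W.card - 1) + N.card := by
      rw [← Finset.sum_erase_add _ _ huW, hNu]
      have : (W.erase u).card • (4 * k ^ 2 : ℝ) ≤
          ∑ w ∈ W.erase u, ((N.filter (G.Adj w)).card : ℝ) * 1 := by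
        refine Finset.card_nsmul_le_sum _ _ _ fun w hw => ?_
        rw [mul_one]
        exact_mod_cast (Finset.mem_filter.1 (Finset.mem_of_mem_erase hw)).2.1
      have hc : (W.card : ℝ) = (W.erase u).card + 1 := by
        exact_mod_cast (Finset.card_erase_add_one huW).symm
      rw [nsmul_eq_mul] at this
      rw [hc]
      linarith
    simp only [Finset.sum_const, nsmul_one] at h2
    nlinarith
  · have h2 := sum_sum_adj_le (q := 2 * k + 1) hG (f := fun _ => (1 : ℝ)) (by simp) (by simp)
      hx0 hx1 Finset.univ
    simp only [← Finset.sum_filter, one_mul, ← hev, ← Finset.mul_sum] at h2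
    simp only [Finset.sum_const, nsmul_one, Finset.card_univ, hV] at h2
    push_cast at h2
    linarith

end Core

section Structure

variable {V : Type*} [DecidableEq V] {G : SimpleGraph V}

theorem exists_zigzag_append {j : ℕ} {K C : Finset V} {d : V} {L : List V}
    (hKC : ∀ a ∈ K, ∀ c ∈ C, G.Adj a c) (hK : K.card = j + 1) (hC : j ≤ C.card)
    (hc : (d :: L).IsChain G.Adj) (hn : (d :: L).Nodup) (hd : ∀ a ∈ K, G.Adj a d)
    (hLK : ∀ v ∈ d :: L, v ∉ K) (hLC : ∀ v ∈ d :: L, v ∉ C) {a : V} (ha : a ∈ K) :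
    ∃ M, (a :: M).IsChain G.Adj ∧ (a :: M).Nodup ∧ (a :: M).length = 2 * j + 1 + (d :: L).length ∧
      ∀ v ∈ a :: M, v ∈ K ∨ v ∈ C ∨ v ∈ d :: L := by
  induction j generalizing K C a with
  | zero =>
    refine ⟨d :: L, ?_, ?_, ?_, ?_⟩
    · rw [List.isChain_cons_cons]
      exact ⟨hd a ha, hc⟩
    · rw [List.nodup_cons]
      exact ⟨fun h => hLK a h ha, hn⟩
    · simp only [List.length_cons]
      omega
    · intro v hv
      rcases List.mem_cons.1 hv with rfl | hv
      · exact Or.inl ha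
      · exact Or.inr (Or.inr hv)
  | succ j ih =>
    obtain ⟨c, hcC⟩ : C.Nonempty := Finset.card_pos.1 (by omega)
    have hK' : (K.erase a).card = j + 1 := by rw [Finset.card_erase_of_mem ha]; omega
    obtain ⟨b, hb⟩ : (K.erase a).Nonempty := Finset.card_pos.1 (by omega)
    have hbK := Finset.mem_of_mem_erase hb
    obtain ⟨M, hM, hMn, hMl, hMs⟩ := ih (K := K.erase a) (C := C.erase c)
      (fun a' ha' c' hc' => hKC _ (Finset.mem_of_mem_erase ha') _ (Finset.mem_of_mem_erase hc'))
      hK' (by rw [Finset.card_erase_of_mem hcC]; omega)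
      (fun a' ha' => hd _ (Finset.mem_of_mem_erase ha'))
      (fun v hv h => hLK v hv (Finset.mem_of_mem_erase h))
      (fun v hv h => hLC v hv (Finset.mem_of_mem_erase h)) hb
    have hKC' : ∀ v ∈ K, v ∉ C := fun v hv h => G.irrefl (hKC v hv v h)
    refine ⟨c :: b :: M, ?_, ?_, ?_, ?_⟩
    · simp only [List.isChain_cons_cons] at hM ⊢
      exact ⟨hKC _ ha _ hcC, (hKC _ hbK _ hcC).symm, hM⟩
    · rw [List.nodup_cons, List.nodup_cons, List.mem_cons]
      refine ⟨?_, ?_, hMn⟩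
      · rintro (h | h)
        · exact hKC' a ha (h ▸ hcC)
        · rcases hMs _ h with h | h | h
          · exact Finset.notMem_erase _ _ h
          · exact hKC' a ha (Finset.mem_of_mem_erase h)
          · exact hLK _ h ha
      · intro h
        rcases hMs _ h with h | h | h
        · exact hKC' c (Finset.mem_of_mem_erase h) hcC
        · exact Finset.notMem_erase _ _ h
        · exact hLC _ h hcC
    · simp only [List.length_cons] at hMl ⊢
      omega
    · intro v hv
      rw [List.mem_cons, List.mem_cons] at hv
      rcases hv with rfl | rfl | hv
      · exact Or.inl ha
      · exact Or.inr (Or.inl hcC)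
      · rcases hMs _ hv with h | h | h
        · exact Or.inl (Finset.mem_of_mem_erase h)
        · exact Or.inr (Or.inl (Finset.mem_of_mem_erase h))
        · exact Or.inr (Or.inr h)

variable {k : ℕ} {K C : Finset V}

/-- No path leaving the core of the graph has three vertices. -/
theorem eq_of_adj_of_adj (hk : 1 ≤ k) (hG : ¬HasPathOn G (2 * k + 3)) (hK : K.card = k)
    (hC : k + 3 ≤ C.card) (hKC : ∀ a ∈ K, ∀ c ∈ C, G.Adj a c) {a u v w : V} (ha : a ∈ K)
    (hu : u ∉ K) (hv : v ∉ K) (hw : w ∉ K) (hau : G.Adj a u) (huv : G.Adj u v) (hvw : G.Adj v w) :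
    w = u := by
  by_contra hne
  have h3 := Finset.le_card_sdiff {u, v, w} C
  have hc3 : ({u, v, w} : Finset V).card ≤ 3 := Finset.card_le_three
  obtain ⟨b, hb⟩ : (C \ {u, v, w}).Nonempty := Finset.card_pos.1 (by omega)
  have hbC := (Finset.mem_sdiff.1 hb).1
  have hb' : b ≠ u ∧ b ≠ v ∧ b ≠ w := by simpa using (Finset.mem_sdiff.1 hb).2
  obtain ⟨M, hM, hMn, hMl, hMs⟩ := exists_zigzag_append (G := G) (j := k - 1) (K := K)
    (C := (C \ {u, v, w}).erase b) (d := b) (L := [])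
    (fun a ha c hc => hKC a ha c (Finset.mem_sdiff.1 (Finset.mem_of_mem_erase hc)).1)
    (by omega) (by rw [Finset.card_erase_of_mem hb]; omega) (by simp) (by simp)
    (fun a ha => hKC a ha b hbC)
    (fun v hv h => by
      rw [List.mem_singleton] at hv
      exact G.irrefl (hKC v h v (hv ▸ hbC)))
    (fun v hv h => by
      rw [List.mem_singleton] at hv
      exact Finset.notMem_erase _ _ (hv ▸ h)) ha
  have hout : ∀ z ∈ ({u, v, w} : Finset V), z ∉ K → z ≠ b → z ∉ a :: M := by
    intro z hz hzK hzb h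
    rcases hMs z h with h | h | h
    · exact hzK h
    · exact (Finset.mem_sdiff.1 (Finset.mem_of_mem_erase h)).2 hz
    · exact hzb (List.mem_singleton.1 h)
  have hlen : (w :: v :: u :: a :: M).length = 2 * k + 3 := by
    simp only [List.length_cons, List.length_nil] at hMl ⊢
    omega
  refine hG (hlen ▸ hasPathOn_of_isChain (by simp) ?_ ?_)
  · simp only [List.isChain_cons_cons] at hM ⊢
    exact ⟨hvw.symm, huv.symm, hau.symm, hM⟩
  · have hcons : ∀ {z y : V} {l : List V}, z ≠ y → z ∉ l → z ∉ y :: l := fun h h' => by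
      rw [List.mem_cons, not_or]
      exact ⟨h, h'⟩
    rw [List.nodup_cons, List.nodup_cons, List.nodup_cons]
    exact ⟨hcons hvw.ne' (hcons hne (hout w (by simp) hw hb'.2.2.symm)),
      hcons huv.ne' (hout v (by simp) hv hb'.2.1.symm), hout u (by simp) hu hb'.1.symm, hMn⟩

/-- There are no two disjoint edges hanging off the core. -/
theorem not_adj_of_disjoint (hk : 1 ≤ k) (hG : ¬HasPathOn G (2 * k + 3)) (hK : K.card = k)
    (hC : k + 3 ≤ C.card) (hKC : ∀ a ∈ K, ∀ c ∈ C, G.Adj a c) {c c' d d' : V}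
    (hc : c ∉ K) (hc' : c' ∉ K) (hd : d ∉ K) (hd' : d' ∉ K) (hcK : ∀ a ∈ K, G.Adj a c)
    (hdK : ∀ a ∈ K, G.Adj a d) (hcc : G.Adj c c') (h1 : c ≠ d) (h2 : c ≠ d') (h3 : c' ≠ d)
    (h4 : c' ≠ d') : ¬G.Adj d d' := by
  intro hdd
  have h := Finset.le_card_sdiff {c, c', d, d'} C
  have hc4 : ({c, c', d, d'} : Finset V).card ≤ 4 := Finset.card_le_four
  obtain ⟨a, ha⟩ : K.Nonempty := Finset.card_pos.1 (by omega)
  obtain ⟨M, hM, hMn, hMl, hMs⟩ := exists_zigzag_append (G := G) (j := k - 1) (K := K)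
    (C := C \ {c, c', d, d'}) (d := d) (L := [d'])
    (fun a ha c hc => hKC a ha c (Finset.mem_sdiff.1 hc).1)
    (by omega) (by omega) (by simpa using hdd) (by simpa using hdd.ne) hdK
    (by simp [hd, hd']) (by simp) ha
  have hout : ∀ z ∈ ({c, c', d, d'} : Finset V), z ∉ K → z ≠ d → z ≠ d' → z ∉ a :: M := by
    intro z hz hzK hzd hzd' h
    rcases hMs z h with h | h | h
    · exact hzK h
    · exact (Finset.mem_sdiff.1 h).2 hz
    · simp_all
  have hlen : (c' :: c :: a :: M).length = 2 * k + 3 := by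
    simp only [List.length_cons, List.length_nil] at hMl ⊢
    omega
  refine hG (hlen ▸ hasPathOn_of_isChain (by simp) ?_ ?_)
  · simp only [List.isChain_cons_cons] at hM ⊢
    exact ⟨hcc.symm, (hcK a ha).symm, hM⟩
  · rw [List.nodup_cons, List.nodup_cons, List.mem_cons, not_or]
    exact ⟨⟨hcc.ne', hout c' (by simp) hc' h3 h4⟩, hout c (by simp) hc h1 h2, hMn⟩

end Structure

section Weights

variable {V : Type*} [DecidableEq V] (G : SimpleGraph V) [DecidableRel G.Adj]

/-- The number of neighbors of `v` in `K`. -/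
def degIn (K : Finset V) (v : V) : ℕ := (K.filter (G.Adj v)).card

/-- The sum of `x` over the neighbors of `v` in `K`. -/
def sumIn (x : V → ℝ) (K : Finset V) (v : V) : ℝ := ∑ w ∈ K.filter (G.Adj v), x w

variable [Fintype V]

/-- The contribution of a vertex `v` outside `K` to the sum of `degIn G K * t * x`, where edges
outside `K` give their weight to the endpoint with fewer neighbors in `K`. -/
noncomputable def contribution (x : V → ℝ) (K : Finset V) (v : V) : ℝ :=
  degIn G K v * sumIn G x K v + ∑ w ∈ Kᶜ.filter (G.Adj v),
    ((if degIn G K v ≤ degIn G K w then degIn G K v * x w else 0) +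
      (if degIn G K v < degIn G K w then degIn G K w * x v else 0))

variable {G} {K : Finset V} {x : V → ℝ} {t : ℝ}

theorem sumIn_nonneg {V : Type*} {G : SimpleGraph V} [DecidableRel G.Adj]
    {K : Finset V} {x : V → ℝ} (hx : ∀ v, 0 ≤ x v) (v : V) : 0 ≤ sumIn G x K v :=
  Finset.sum_nonneg fun w _ => hx w

theorem sumIn_le {V : Type*} {G : SimpleGraph V} [DecidableRel G.Adj]
    {K : Finset V} {x : V → ℝ} (hx : ∀ v, 0 ≤ x v) (v : V) : sumIn G x K v ≤ ∑ a ∈ K, x a :=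
  Finset.sum_le_sum_of_subset_of_nonneg (Finset.filter_subset _ _) fun w _ _ => hx w

theorem mul_eq_sumIn_add_sumIn (hev : ∀ v, t * x v = ∑ w with G.Adj v w, x w) (v : V) :
    t * x v = sumIn G x K v + sumIn G x Kᶜ v := by
  rw [hev, sumIn, sumIn, Finset.sum_filter, Finset.sum_filter, Finset.sum_filter,
    Finset.sum_add_sum_compl]

theorem sum_degIn_mul_eq (hev : ∀ v, t * x v = ∑ w with G.Adj v w, x w) :
    ∑ v ∈ Kᶜ, (degIn G K v : ℝ) * (t * x v) = ∑ v ∈ Kᶜ, contribution G x K v := by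
  have h1 : ∑ v ∈ Kᶜ, ∑ w ∈ Kᶜ, (if G.Adj v w then
      (if degIn G K w < degIn G K v then degIn G K v * x w else 0) else 0) =
      ∑ v ∈ Kᶜ, ∑ w ∈ Kᶜ, (if G.Adj v w then
      (if degIn G K v < degIn G K w then degIn G K w * x v else 0) else 0) := by
    rw [Finset.sum_comm]
    simp only [G.adj_comm]
  simp only [contribution, Finset.sum_add_distrib, Finset.sum_filter]
  rw [← h1, ← Finset.sum_add_distrib, ← Finset.sum_add_distrib]
  refine Finset.sum_congr rfl fun v _ => ?_
  rw [mul_eq_sumIn_add_sumIn hev v (K := K), mul_add, ← Finset.sum_add_distrib]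
  congr 1
  rw [sumIn, Finset.sum_filter, Finset.mul_sum]
  refine Finset.sum_congr rfl fun w _ => ?_
  by_cases h : G.Adj v w
  · by_cases h2 : degIn G K v ≤ degIn G K w
    · simp [h, h2, not_lt.2 h2]
    · simp [h, h2, not_le.1 h2]
  · simp [h]

theorem sq_mul_sum_eq (hev : ∀ v, t * x v = ∑ w with G.Adj v w, x w) :
    t ^ 2 * ∑ a ∈ K, x a = t * ∑ a ∈ K, (degIn G K a : ℝ) * x a +
      ∑ v ∈ Kᶜ, contribution G x K v := by
  have h := sum_sum_filter_adj (G := G) K (fun v => t * x v)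
  simp only [← Finset.mul_sum, ← hev] at h
  have h1 : t * ∑ a ∈ K, (degIn G K a : ℝ) * x a = ∑ a ∈ K, (degIn G K a : ℝ) * (t * x a) := by
    rw [Finset.mul_sum]
    exact Finset.sum_congr rfl fun a _ => mul_left_comm _ _ _
  rw [← sum_degIn_mul_eq hev, h1, Finset.sum_add_sum_compl, pow_two, mul_assoc]
  exact h

theorem filter_compl_eq_singleton
    (hR : ∀ u v w, u ∉ K → v ∉ K → w ∉ K → 0 < degIn G K u → G.Adj u v → G.Adj v w → w = u)
    {u v : V} (hu : u ∉ K) (hv : v ∉ K) (h0 : 0 < degIn G K u) (huv : G.Adj u v) :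
    Kᶜ.filter (G.Adj v) = {u} := by
  ext w
  simp only [Finset.mem_filter, Finset.mem_compl, Finset.mem_singleton]
  constructor
  · rintro ⟨hw, hvw⟩
    exact hR u v w hu hv hw h0 huv hvw
  · rintro rfl
    exact ⟨hu, huv.symm⟩

theorem lt_sum_of_degIn_eq_zero (hx : ∀ v, 0 ≤ x v)
    (hev : ∀ v, t * x v = ∑ w with G.Adj v w, x w)
    (hR : ∀ u v w, u ∉ K → v ∉ K → w ∉ K → 0 < degIn G K u → G.Adj u v → G.Adj v w → w = u)
    (hS : 0 < ∑ a ∈ K, x a) (ht0 : 0 < t) (ht : (Kᶜ.card : ℝ) < t ^ 2) {v w : V} (hv : v ∉ K)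
    (hw : w ∉ K) (hvw : G.Adj v w) (hv0 : degIn G K v = 0) (hw0 : 0 < degIn G K w) :
    x v < ∑ a ∈ K, x a := by
  have hnbr : ∀ w' ∈ Kᶜ.filter (G.Adj w), t * x w' = x w := by
    intro w' hw'
    rw [Finset.mem_filter, Finset.mem_compl] at hw'
    have hd : degIn G K w' = 0 := by
      by_contra h
      have := hR w' w v hw'.1 hw hv (Nat.pos_of_ne_zero h) hw'.2.symm hvw.symm
      exact h (this ▸ hv0)
    rw [mul_eq_sumIn_add_sumIn hev w' (K := K), sumIn, sumIn,
      filter_compl_eq_singleton hR hw hw'.1 hw0 hw'.2, Finset.sum_singleton,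
      Finset.card_eq_zero.1 hd, Finset.sum_empty, zero_add]
  have hxw : t * x v = x w := hnbr v (by simp [hv, hvw.symm])
  have h1 : t * (t * x w) = t * sumIn G x K w + (Kᶜ.filter (G.Adj w)).card * x w := by
    rw [mul_eq_sumIn_add_sumIn hev w (K := K), mul_add, sumIn.eq_1 _ _ Kᶜ, Finset.mul_sum,
      Finset.sum_congr rfl hnbr, Finset.sum_const, nsmul_eq_mul]
  have hr : ((Kᶜ.filter (G.Adj w)).card : ℝ) + 1 ≤ Kᶜ.card := by
    have : (Kᶜ.filter (G.Adj w)).card < Kᶜ.card := by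
      refine Finset.card_lt_card ((Finset.filter_ssubset).2 ⟨w, by simpa using hw, by simp⟩)
    exact_mod_cast this
  have h2 : t ^ 2 * x v = sumIn G x K w + (Kᶜ.filter (G.Adj w)).card * x v := by
    rw [← hxw] at h1
    refine mul_left_cancel₀ ht0.ne' ?_
    linarith
  have h3 := sumIn_le (G := G) (K := K) hx w
  by_contra! hle
  nlinarith

theorem sub_one_mul_le_sum (hx : ∀ v, 0 ≤ x v)
    (hev : ∀ v, t * x v = ∑ w with G.Adj v w, x w)
    (hR : ∀ u v w, u ∉ K → v ∉ K → w ∉ K → 0 < degIn G K u → G.Adj u v → G.Adj v w → w = u)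
    (ht : 1 < t) {v w : V} (hv : v ∉ K) (hw : w ∉ K) (hvw : G.Adj v w) (hv0 : 0 < degIn G K v)
    (hw0 : 0 < degIn G K w) : (t - 1) * x v ≤ ∑ a ∈ K, x a := by
  have h1 := mul_eq_sumIn_add_sumIn hev v (K := K)
  have h2 := mul_eq_sumIn_add_sumIn hev w (K := K)
  rw [sumIn.eq_1 _ _ Kᶜ, filter_compl_eq_singleton hR hw hv hw0 hvw.symm,
    Finset.sum_singleton] at h1
  rw [sumIn.eq_1 _ _ Kᶜ, filter_compl_eq_singleton hR hv hw hv0 hvw, Finset.sum_singleton] at h2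
  have h3 := sumIn_le (G := G) (K := K) hx v
  have h4 := sumIn_le (G := G) (K := K) hx w
  by_contra! hlt
  have h5 : (t + 1) * ∑ a ∈ K, x a < (t + 1) * ((t - 1) * x v) :=
    mul_lt_mul_of_pos_left hlt (by linarith)
  have h6 : t * sumIn G x K v ≤ t * ∑ a ∈ K, x a := mul_le_mul_of_nonneg_left h3 (by linarith)
  have h7 : t * (t * x v) = t * sumIn G x K v + (sumIn G x K w + x v) := by
    rw [h1, mul_add, h2]
  nlinarith

theorem contribution_le {k : ℕ} (hx : ∀ v, 0 ≤ x v)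
    (hev : ∀ v, t * x v = ∑ w with G.Adj v w, x w)
    (hR : ∀ u v w, u ∉ K → v ∉ K → w ∉ K → 0 < degIn G K u → G.Adj u v → G.Adj v w → w = u)
    (hS : 0 < ∑ a ∈ K, x a) (hk : 1 ≤ k) (hK : K.card = k) (ht1 : 2 * k + 1 ≤ t)
    (ht : (Kᶜ.card : ℝ) < t ^ 2) {v : V} (hv : v ∉ K) :
    contribution G x K v < k * ∑ a ∈ K, x a ∨
    degIn G K v = k ∧ contribution G x K v ≤ k * ∑ a ∈ K, x a ∨
    degIn G K v = k ∧ (∃ w ∉ K, G.Adj v w ∧ degIn G K w = k) ∧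
      contribution G x K v ≤ k * ∑ a ∈ K, x a + k * (∑ a ∈ K, x a) / (t - 1) := by
  have hdk : ∀ w, degIn G K w ≤ k := fun w => hK ▸ Finset.card_filter_le _ _
  have hdkR : ∀ w, (degIn G K w : ℝ) ≤ k := fun w => by exact_mod_cast hdk w
  have hkR : (1 : ℝ) ≤ k := by exact_mod_cast hk
  have hSv := sumIn_le (G := G) (K := K) hx v
  have hSv0 := sumIn_nonneg (G := G) (K := K) hx v
  set S := ∑ a ∈ K, x a with hSdef
  have hdS : (degIn G K v : ℝ) * sumIn G x K v ≤ degIn G K v * S :=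
    mul_le_mul_of_nonneg_left hSv (by positivity)
  have hlt : degIn G K v < k → (degIn G K v : ℝ) + 1 ≤ k := fun h => by exact_mod_cast h
  by_cases hex : ∃ w ∉ K, G.Adj v w ∧ degIn G K v ≤ degIn G K w ∧ 0 < degIn G K w
  · obtain ⟨w, hw, hvw, hle, hw0⟩ := hex
    have hz : contribution G x K v = degIn G K v * sumIn G x K v +
        (degIn G K v * x w + if degIn G K v < degIn G K w then degIn G K w * x v else 0) := by
      rw [contribution, filter_compl_eq_singleton hR hw hv hw0 hvw.symm, Finset.sum_singleton,
        if_pos hle]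
    rcases Nat.eq_zero_or_pos (degIn G K v) with hv0 | hv0
    · left
      have hlt' := lt_sum_of_degIn_eq_zero hx hev hR hS (by linarith) ht hv hw hvw hv0 hw0
      rw [hz, hv0, if_pos hw0]
      simp only [Nat.cast_zero, zero_mul, zero_add]
      calc (degIn G K w : ℝ) * x v ≤ k * x v := mul_le_mul_of_nonneg_right (hdkR w) (hx v)
        _ < k * S := mul_lt_mul_of_pos_left hlt' (by linarith)
    · have h1 := sub_one_mul_le_sum hx hev hR (by linarith) hv hw hvw hv0 hw0
      have h2 := sub_one_mul_le_sum hx hev hR (by linarith) hw hv hvw.symm hw0 hv0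
      have ht' : 0 < t - 1 := by linarith
      have hxv : x v ≤ S / (t - 1) := by rw [le_div_iff₀ ht']; linarith
      have hxw : x w ≤ S / (t - 1) := by rw [le_div_iff₀ ht']; linarith
      have he0 : 0 < S / (t - 1) := div_pos hS ht'
      have hek : 2 * k * (S / (t - 1)) ≤ S := by
        rw [mul_div_assoc', div_le_iff₀ ht']
        nlinarith
      have h3 : (degIn G K v : ℝ) * x w ≤ degIn G K v * (S / (t - 1)) :=
        mul_le_mul_of_nonneg_left hxw (by positivity)
      rcases hle.eq_or_lt with heq | hlt'
      · rw [if_neg (by omega), add_zero] at hz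
        rcases (hdk v).eq_or_lt with hvk | hvk
        · right; right
          refine ⟨hvk, ⟨w, hw, hvw, heq ▸ hvk⟩, ?_⟩
          rw [hz, mul_div_assoc]
          rw [hvk] at h3 hdS ⊢
          linarith
        · left
          have := hlt hvk
          rw [hz]
          nlinarith
      · left
        rw [if_pos hlt'] at hz
        have hd1 := hlt (hlt'.trans_le (hdk w))
        have h4 : (degIn G K w : ℝ) * x v ≤ k * (S / (t - 1)) :=
          mul_le_mul (hdkR w) hxv (hx v) (by linarith)
        rw [hz]
        nlinarith
  · have hz : contribution G x K v = degIn G K v * sumIn G x K v := by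
      rw [contribution, Finset.sum_eq_zero, add_zero]
      intro w hw
      rw [Finset.mem_filter, Finset.mem_compl] at hw
      by_cases hle : degIn G K v ≤ degIn G K w
      · have hw0 : degIn G K w = 0 := by
          by_contra h
          exact hex ⟨w, hw.1, hw.2, hle, Nat.pos_of_ne_zero h⟩
        have hv0 : degIn G K v = 0 := by omega
        simp [hw0, hv0]
      · rw [if_neg hle, if_neg (by omega), add_zero]
    rcases (hdk v).eq_or_lt with hvk | hvk
    · right; left
      rw [hz]
      rw [hvk] at hdS ⊢
      exact ⟨rfl, hdS⟩
    · left
      have := hlt hvk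
      rw [hz]
      nlinarith

end Weights

section Rigidity

theorem adj_of_degIn_eq {V : Type*} {G : SimpleGraph V} [DecidableRel G.Adj] {K : Finset V}
    {k : ℕ} (hK : K.card = k) {v : V} (hv : degIn G K v = k) {a : V} (ha : a ∈ K) :
    G.Adj a v := by
  have h : K.filter (G.Adj v) = K :=
    Finset.eq_of_subset_of_card_le (Finset.filter_subset _ _) (by rw [hK]; exact hv.ge)
  rw [← h, Finset.mem_filter] at ha
  exact ha.2.symm

variable {V : Type*} [Fintype V] [DecidableEq V] {G : SimpleGraph V} [DecidableRel G.Adj]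
  {K C : Finset V} {k : ℕ}

/-- If the spectral radius of `G` is at least that of `S_{n,k}^+`, then the core of `G` is
a clique joined to all other vertices, and there is exactly one further edge. -/
theorem adj_iff_of_complete_bipartite {n : ℕ} (hk : 1 ≤ k) (hV : Fintype.card V = n)
    (hkn : k + 2 ≤ n)
    (hG : ¬HasPathOn G (2 * k + 3)) {t : ℝ} {x : V → ℝ} (hx : ∀ v, 0 ≤ x v)
    (hev : ∀ v, t * x v = ∑ w with G.Adj v w, x w) (ht1 : 2 * k + 1 ≤ t)
    (ht2 : (k - 1) * t + k * (n - k) + 2 * k / (t - 1) ≤ t ^ 2) (hK : K.card = k)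
    (hxK : ∀ a ∈ K, 0 < x a) (hC : k + 3 ≤ C.card) (hKC : ∀ a ∈ K, ∀ c ∈ C, G.Adj a c) :
    ∃ c ∉ K, ∃ c' ∉ K, c ≠ c' ∧ ∀ v w, G.Adj v w ↔ v ≠ w ∧
      (v ∈ K ∨ w ∈ K ∨ (v = c ∧ w = c') ∨ (v = c' ∧ w = c)) := by
  have hkR : (1 : ℝ) ≤ k := by exact_mod_cast hk
  have hknR : (k + 2 : ℝ) ≤ n := by exact_mod_cast hkn
  have ht' : 0 < t - 1 := by linarith
  have hS : 0 < ∑ a ∈ K, x a := Finset.sum_pos hxK (Finset.card_pos.1 (by omega))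
  have hR : ∀ u v w, u ∉ K → v ∉ K → w ∉ K → 0 < degIn G K u → G.Adj u v → G.Adj v w → w = u := by
    intro u v w hu hv hw h0 huv hvw
    obtain ⟨a, ha⟩ := Finset.card_pos.1 h0
    rw [Finset.mem_filter] at ha
    exact eq_of_adj_of_adj hk hG hK hC hKC ha.1 hu hv hw ha.2.symm huv hvw
  have hKc : (Kᶜ.card : ℝ) = n - k := by
    rw [eq_sub_iff_add_eq, add_comm, ← hV, ← hK]
    exact_mod_cast K.card_add_card_compl
  have hfrac : 0 < 2 * k / (t - 1) := by positivity
  have ht : (Kᶜ.card : ℝ) < t ^ 2 := by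
    rw [hKc]
    nlinarith
  have hcon := fun v => contribution_le (v := v) hx hev hR hS hk hK ht1 ht
  have hsq := sq_mul_sum_eq (K := K) hev
  set S := ∑ a ∈ K, x a with hSdef
  set e := k * S / (t - 1) with he
  have he0 : 0 < e := by positivity
  set F : Finset V := Kᶜ.filter
    (fun v => degIn G K v = k ∧ ∃ w ∉ K, G.Adj v w ∧ degIn G K w = k) with hF
  have hFsub : ∀ {v w}, v ∉ K → w ∉ K → degIn G K v = k → degIn G K w = k → G.Adj v w →
      F ⊆ {v, w} := by
    intro v w hv hw hvk hwk hvw z hz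
    rw [hF, Finset.mem_filter, Finset.mem_compl] at hz
    obtain ⟨hzK, hzk, z', hzK', hzz, hzk'⟩ := hz
    by_contra hne
    rw [Finset.mem_insert, Finset.mem_singleton, not_or] at hne
    refine not_adj_of_disjoint hk hG hK hC hKC hv hw hzK hzK' (fun a ha => adj_of_degIn_eq hK hvk ha)
      (fun a ha => adj_of_degIn_eq hK hzk ha) hvw (Ne.symm hne.1) ?_ (Ne.symm hne.2) ?_ hzz
    · rintro rfl
      exact hne.2 (hR w v z hw hv hzK (by omega) hvw.symm hzz.symm)
    · rintro rfl
      exact hne.1 (hR v w z hv hw hzK (by omega) hvw hzz.symm)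
  have hF2 : F.card ≤ 2 := by
    rcases F.eq_empty_or_nonempty with h | ⟨v, hv⟩
    · simp [h]
    · have hv' := hv
      rw [hF, Finset.mem_filter, Finset.mem_compl] at hv'
      obtain ⟨hvK, hvk, w, hwK, hvw, hwk⟩ := hv'
      exact (Finset.card_le_card (hFsub hvK hwK hvk hwk hvw)).trans Finset.card_le_two
  have hconF : ∀ v ∈ Kᶜ, contribution G x K v ≤ k * S + if v ∈ F then e else 0 := by
    intro v hv
    have hvK := Finset.mem_compl.1 hv
    have hite : 0 ≤ if v ∈ F then e else 0 := by
      split_ifs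
      · exact he0.le
      · exact le_rfl
    rcases hcon v hvK with h | ⟨-, h⟩ | ⟨h1, h2, h⟩
    · linarith
    · linarith
    · rwa [if_pos (by rw [hF, Finset.mem_filter]; exact ⟨hv, h1, h2⟩)]
  have hsum : ∑ v ∈ Kᶜ, (k * S + if v ∈ F then e else 0) = (n - k) * (k * S) + F.card * e := by
    rw [Finset.sum_add_distrib, Finset.sum_const, nsmul_eq_mul, hKc, Finset.sum_ite_mem,
      Finset.inter_eq_right.2 (Finset.filter_subset _ _), Finset.sum_const, nsmul_eq_mul]
  have hcons := Finset.sum_le_sum hconF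
  rw [hsum] at hcons
  have hdK : ∀ a ∈ K, degIn G K a + 1 ≤ k := by
    intro a ha
    rw [← hK]
    exact Finset.card_lt_card (Finset.filter_ssubset.2 ⟨a, ha, by simp⟩)
  have hdKx : ∀ a ∈ K, (degIn G K a : ℝ) * x a ≤ (k - 1) * x a := by
    intro a ha
    refine mul_le_mul_of_nonneg_right ?_ (hx a)
    rw [le_sub_iff_add_le]
    exact_mod_cast hdK a ha
  have hdKs := Finset.sum_le_sum hdKx
  rw [← Finset.mul_sum, ← hSdef] at hdKs
  have hmain : (k - 1) * t * S + (n - k) * (k * S) + 2 * e ≤ t ^ 2 * S := by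
    have h := mul_le_mul_of_nonneg_right ht2 hS.le
    have h2 : 2 * k / (t - 1) * S = 2 * e := by
      rw [he]
      ring
    linarith
  have hFR : (F.card : ℝ) * e ≤ 2 * e := by
    refine mul_le_mul_of_nonneg_right ?_ he0.le
    exact_mod_cast hF2
  have htK : t * ∑ a ∈ K, (degIn G K a : ℝ) * x a ≤ t * ((k - 1) * S) :=
    mul_le_mul_of_nonneg_left hdKs (by linarith)
  have hfull : ∀ v ∉ K, degIn G K v = k := by
    intro v hv
    by_contra hne
    have hlt : ∑ v ∈ Kᶜ, contribution G x K v < ∑ v ∈ Kᶜ, (k * S + if v ∈ F then e else 0) := by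
      refine Finset.sum_lt_sum hconF ⟨v, by simpa using hv, ?_⟩
      rcases hcon v hv with h | ⟨h, -⟩ | ⟨h, -⟩
      · rw [if_neg (by rw [hF, Finset.mem_filter]; exact fun h => hne h.2.1)]
        linarith
      · exact absurd h hne
      · exact absurd h hne
    rw [hsum] at hlt
    linarith
  have hclique : ∀ a ∈ K, degIn G K a + 1 = k := by
    intro a ha
    by_contra hne
    have hlt : ∑ a ∈ K, (degIn G K a : ℝ) * x a < ∑ a ∈ K, (k - 1) * x a := by
      refine Finset.sum_lt_sum hdKx ⟨a, ha, mul_lt_mul_of_pos_right ?_ (hxK a ha)⟩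
      rw [lt_sub_iff_add_lt]
      exact_mod_cast lt_of_le_of_ne (hdK a ha) hne
    rw [← Finset.mul_sum, ← hSdef] at hlt
    have := mul_lt_mul_of_pos_left hlt (show 0 < t by linarith)
    linarith
  have hFc : F.card = 2 := by
    by_contra hne
    have : (F.card : ℝ) ≤ 1 := by exact_mod_cast (by omega : F.card ≤ 1)
    have := mul_le_mul_of_nonneg_right this he0.le
    linarith
  obtain ⟨c, hc⟩ : F.Nonempty := Finset.card_pos.1 (by omega)
  rw [hF, Finset.mem_filter, Finset.mem_compl] at hc
  obtain ⟨hcK, hck, c', hcK', hcc, hck'⟩ := hc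
  have hKadj : ∀ a ∈ K, ∀ v, a ≠ v → G.Adj a v := by
    intro a ha v hav
    by_cases hv : v ∈ K
    · have hsub : K.filter (G.Adj a) ⊆ K.erase a := by
        intro b hb
        rw [Finset.mem_filter] at hb
        exact Finset.mem_erase.2 ⟨hb.2.ne', hb.1⟩
      have heq := Finset.eq_of_subset_of_card_le hsub (by
        rw [Finset.card_erase_of_mem ha, hK]
        have := hclique a ha
        unfold degIn at this
        omega)
      have : v ∈ K.filter (G.Adj a) := heq ▸ Finset.mem_erase.2 ⟨hav.symm, hv⟩
      exact (Finset.mem_filter.1 this).2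
    · exact adj_of_degIn_eq hK (hfull v hv) ha
  refine ⟨c, hcK, c', hcK', hcc.ne, fun v w => ⟨fun h => ⟨h.ne, ?_⟩, ?_⟩⟩
  · by_cases hv : v ∈ K
    · exact Or.inl hv
    by_cases hw : w ∈ K
    · exact Or.inr (Or.inl hw)
    have hmem : ∀ {v w}, v ∉ K → w ∉ K → G.Adj v w → v = c ∨ v = c' := by
      intro v w hv hw hvw
      have : v ∈ F := by
        rw [hF, Finset.mem_filter, Finset.mem_compl]
        exact ⟨hv, hfull v hv, w, hw, hvw, hfull w hw⟩
      simpa using hFsub hcK hcK' hck hck' hcc this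
    have h1 := hmem hv hw h
    have h2 := hmem hw hv h.symm
    have h3 := h.ne
    grind
  · rintro ⟨hne, h | h | ⟨rfl, rfl⟩ | ⟨rfl, rfl⟩⟩
    · exact hKadj v h w hne
    · exact (hKadj w h v hne.symm).symm
    · exact hcc
    · exact hcc.symm

end Rigidity

section Isomorphism

theorem exists_equiv_fin {k n : ℕ} (hkn : k + 2 ≤ n) {K : Finset (Fin n)} (hK : K.card = k)
    {c c' : Fin n} (hc : c ∉ K) (hc' : c' ∉ K) (hcc : c ≠ c') :
    ∃ σ : Fin n ≃ Fin n, (∀ v, (σ v : ℕ) < k ↔ v ∈ K) ∧ (σ c : ℕ) = k ∧ (σ c' : ℕ) = k + 1 := by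
  have hcard : Fintype.card {v // v ∈ K} = Fintype.card {i : Fin n // (i : ℕ) < k} := by
    rw [Fintype.card_coe, hK, Fintype.card_subtype, Fin.card_filter_val_lt]
    omega
  obtain ⟨e⟩ := Fintype.card_eq.1 hcard
  have h0 : ∀ v, (e.extendSubtype v : ℕ) < k ↔ v ∈ K := fun v =>
    ⟨fun h => by
      by_contra hv
      exact e.extendSubtype_not_mem v hv h, fun hv => e.extendSubtype_mem v hv⟩
  set σ₁ := e.extendSubtype.trans (Equiv.swap (e.extendSubtype c) ⟨k, by omega⟩) with hσ₁
  have hswap : ∀ {a b : Fin n}, k ≤ (a : ℕ) → k ≤ (b : ℕ) → ∀ i,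
      (Equiv.swap a b i : ℕ) < k ↔ (i : ℕ) < k := by
    intro a b ha hb i
    rw [Equiv.swap_apply_def]
    split_ifs with h1 h2
    · subst h1
      omega
    · subst h2
      omega
    · rfl
  have h1 : ∀ v, (σ₁ v : ℕ) < k ↔ v ∈ K := fun v => by
    rw [hσ₁, Equiv.trans_apply, hswap (not_lt.1 (mt (h0 c).1 hc)) (by simp), h0]
  have h1c : (σ₁ c : ℕ) = k := by simp [hσ₁]
  have h1c' : (σ₁ c' : ℕ) ≠ k := fun h => hcc (σ₁.injective (Fin.ext (h1c.trans h.symm)))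
  refine ⟨σ₁.trans (Equiv.swap (σ₁ c') ⟨k + 1, by omega⟩), fun v => ?_, ?_, by simp⟩
  · rw [Equiv.trans_apply, hswap (not_lt.1 (mt (h1 c').1 hc')) (by simp), h1]
  · rw [Equiv.trans_apply, Equiv.swap_apply_of_ne_of_ne, h1c]
    · exact fun h => hcc (σ₁.injective h)
    · exact fun h => by simp [Fin.ext_iff, h1c] at h

theorem nonempty_iso_snkPlus {k n : ℕ} (hkn : k + 2 ≤ n) {G : SimpleGraph (Fin n)}
    {K : Finset (Fin n)} (hK : K.card = k) {c c' : Fin n} (hc : c ∉ K) (hc' : c' ∉ K)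
    (hcc : c ≠ c') (hadj : ∀ v w, G.Adj v w ↔ v ≠ w ∧
      (v ∈ K ∨ w ∈ K ∨ (v = c ∧ w = c') ∨ (v = c' ∧ w = c))) :
    Nonempty (G ≃g SnkPlus n k) := by
  obtain ⟨σ, h1, h2, h3⟩ := exists_equiv_fin hkn hK hc hc' hcc
  have hσc : ∀ v, (σ v : ℕ) = k ↔ v = c := fun v => by
    rw [← h2, ← Fin.ext_iff, σ.injective.eq_iff]
  have hσc' : ∀ v, (σ v : ℕ) = k + 1 ↔ v = c' := fun v => by
    rw [← h3, ← Fin.ext_iff, σ.injective.eq_iff]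
  refine ⟨⟨σ, fun {v w} => ?_⟩⟩
  rw [snkPlus_adj, hadj, h1, h1, hσc, hσc, hσc', hσc', Ne, ← Fin.ext_iff, σ.injective.eq_iff]

end Isomorphism

/-- Nikiforov: if `k ≥ 1`, `n ≥ 2^{4k+4}` and `μ(G) ≥ μ(S_{n,k}^+)`, then
`P_{2k+3} ⊆ G` unless `G ≅ S_{n,k}^+`. -/
theorem stmt_15 (k n : ℕ) (hk : 1 ≤ k) (hn : 2 ^ (4 * k + 4) ≤ n) (G : SimpleGraph (Fin n))
    (hμ : muIndex (SnkPlus n k) ≤ muIndex G) :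
    HasPathOn G (2 * k + 3) ∨ Nonempty (G ≃g SnkPlus n k) := by
  classical
  refine or_iff_not_imp_left.2 fun hG => ?_
  have hn16 := sixteen_mul_le hn
  have : Nonempty (Fin n) := ⟨⟨0, by omega⟩⟩
  obtain ⟨x, hx0, hx1, ⟨u, hu⟩, hev⟩ := exists_perron_vector G
  have ht1 := two_mul_add_one_le_of_muIndex_le hk hn hμ
  have ht2 := le_sq_of_muIndex_le hk hn hμ
  obtain ⟨K, C, hK, hxK, hC, hKC⟩ := exists_complete_bipartite hk hn (Fintype.card_fin n) hG
    hx0 hx1 hu hev ht1 ht2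
  obtain ⟨c, hc, c', hc', hcc, hadj⟩ := adj_iff_of_complete_bipartite hk (Fintype.card_fin n)
    (by omega) hG hx0 hev ht1 ht2 hK hxK hC hKC
  exact nonempty_iso_snkPlus (by omega) hK hc hc' hcc hadj
end

section
/- Let k ≥ 1 and let G be a simple graph of order n with 2n > 5k + 3. If q(G) ≥ q(S_{n,k}), then G contains a matching of k+1 edges, unless G is isomorphic to S_{n,k}. -/
open Matrix BigOperators

/-- Each coordinate of `Q x` is a sum of `x v + x w` over the neighbours `w` of `v`. -/
theorem signlessLaplacian_mulVec_apply {V : Type*} [Fintype V] [DecidableEq V]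
    (G : SimpleGraph V) [DecidableRel G.Adj] (x : V → ℝ) (v : V) :
    (signlessLaplacian G *ᵥ x) v = ∑ w, if G.Adj v w then x v + x w else 0 := by
  have hdeg : (deg G v : ℝ) = ∑ w, if G.Adj v w then (1 : ℝ) else 0 := by
    rw [deg, Nat.card_eq_fintype_card, G.card_neighborSet_eq_degree, ← G.card_neighborFinset_eq_degree,
      G.neighborFinset_eq_filter]
    simp
  unfold signlessLaplacian
  rw [Matrix.add_mulVec, Pi.add_apply, Matrix.mulVec_diagonal, hdeg, Finset.sum_mul, Matrix.mulVec,
    dotProduct, ← Finset.sum_add_distrib]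
  refine Finset.sum_congr rfl fun w _ => ?_
  by_cases h : G.Adj v w <;> simp [SimpleGraph.adjMatrix_apply, h]

theorem le_qIndex_of_mulVec_eq {V : Type*} [Fintype V] [DecidableEq V] {G : SimpleGraph V}
    {ρ : ℝ} {x : V → ℝ} (hx : x ≠ 0) (h : signlessLaplacian G *ᵥ x = ρ • x) : ρ ≤ qIndex G := by
  have hev : Module.End.HasEigenvalue (Matrix.toLin' (signlessLaplacian G)) ρ :=
    Module.End.hasEigenvalue_of_hasEigenvector
      (Module.End.hasEigenvector_iff.2 ⟨Module.End.mem_eigenspace_iff.2 (by simpa using h), hx⟩)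
  have hmem : ρ ∈ spectrum ℝ (signlessLaplacian G) := by
    rw [← Matrix.spectrum_toLin']
    exact hev.mem_spectrum
  rw [(signlessLaplacian_isHermitian G).spectrum_real_eq_range_eigenvalues] at hmem
  obtain ⟨i, rfl⟩ := hmem
  exact le_ciSup (f := (signlessLaplacian_isHermitian G).eigenvalues)
    (Set.finite_range _).bddAbove i

theorem exists_mulVec_eq_qIndex {V : Type*} [Fintype V] [DecidableEq V] [Nonempty V]
    (G : SimpleGraph V) :
    ∃ z : V → ℝ, z ≠ 0 ∧ signlessLaplacian G *ᵥ z = qIndex G • z := by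
  obtain ⟨i, hi⟩ := exists_eq_ciSup_of_finite
    (f := (signlessLaplacian_isHermitian G).eigenvalues)
  refine ⟨((signlessLaplacian_isHermitian G).eigenvectorBasis i : V → ℝ), fun h => ?_, ?_⟩
  · refine (signlessLaplacian_isHermitian G).eigenvectorBasis.toBasis.ne_zero i ?_
    ext j
    simpa using congrFun h j
  · rw [(signlessLaplacian_isHermitian G).mulVec_eigenvectorBasis, hi, qIndex]

/-- A Collatz–Wielandt bound: a positive vector `x` with `Q x ≤ ρ x`, strict at `u` and at every
vertex not adjacent to `u`, certifies `q(G) < ρ`. -/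
theorem qIndex_lt_of_mulVec_le {V : Type*} [Fintype V] [DecidableEq V] {G : SimpleGraph V}
    {ρ : ℝ} {x : V → ℝ} (hx : ∀ v, 0 < x v)
    (hle : ∀ v, (signlessLaplacian G *ᵥ x) v ≤ ρ * x v) {u : V}
    (hstrict : ∀ v, G.Adj v u ∨ (signlessLaplacian G *ᵥ x) v < ρ * x v) : qIndex G < ρ := by
  classical
  have : Nonempty V := ⟨u⟩
  by_contra! hq
  obtain ⟨z, hz, hQz⟩ := exists_mulVec_eq_qIndex G
  obtain ⟨v, hv⟩ := Finite.exists_max (fun v => |z v| / x v)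
  set r := |z v| / x v with hr
  have hzr : ∀ w, |z w| ≤ r * x w := fun w => (div_le_iff₀ (hx w)).1 (hv w)
  have hzx : |z v| = r * x v := by rw [hr, div_mul_cancel₀ _ (hx v).ne']
  have hr0 : 0 < r := by
    obtain ⟨w, hw⟩ := Function.ne_iff.1 hz
    have h1 : 0 < |z w| := abs_pos.2 hw
    exact pos_of_mul_pos_left (h1.trans_le (hzr w)) (hx w).le
  have hrow : ∀ a, ρ * |z a| ≤ ∑ w, if G.Adj a w then |z a| + |z w| else 0 := by
    intro a
    have h1 : qIndex G * z a = ∑ w, if G.Adj a w then z a + z w else 0 := by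
      rw [← signlessLaplacian_mulVec_apply, hQz, Pi.smul_apply, smul_eq_mul]
    calc ρ * |z a| ≤ |qIndex G * z a| := by
          rw [abs_mul]
          exact mul_le_mul_of_nonneg_right (hq.trans (le_abs_self _)) (abs_nonneg _)
      _ ≤ ∑ w, |if G.Adj a w then z a + z w else 0| := by
          rw [h1]
          exact Finset.abs_sum_le_sum_abs _ _
      _ ≤ _ := by
          refine Finset.sum_le_sum fun w _ => ?_
          split_ifs
          · exact abs_add_le _ _
          · simp
  have hterm : ∀ a w, (if G.Adj a w then |z a| + |z w| else 0)
      ≤ r * (if G.Adj a w then x a + x w else 0) := by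
    intro a w
    split_ifs
    · linarith [hzr a, hzr w]
    · simp
  have hnot : ∀ a, |z a| = r * x a → ¬ (signlessLaplacian G *ᵥ x) a < ρ * x a := by
    intro a ha hlt
    have h1 := (hrow a).trans (Finset.sum_le_sum fun w _ => hterm a w)
    rw [← Finset.mul_sum, ← signlessLaplacian_mulVec_apply, ha] at h1
    nlinarith [mul_lt_mul_of_pos_left hlt hr0]
  have hadj : G.Adj v u := (hstrict v).resolve_right (hnot v hzx)
  have huu : (signlessLaplacian G *ᵥ x) u < ρ * x u := (hstrict u).resolve_left (G.irrefl)
  refine hnot u ?_ huu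
  by_contra hne
  have hlt : |z u| < r * x u := lt_of_le_of_ne (hzr u) hne
  have h1 := (hrow v).trans_lt (Finset.sum_lt_sum (fun w _ => hterm v w) ⟨u, Finset.mem_univ _, by
    rw [if_pos hadj, if_pos hadj]
    linarith⟩)
  rw [← Finset.mul_sum, ← signlessLaplacian_mulVec_apply, hzx] at h1
  nlinarith [mul_le_mul_of_nonneg_left (hle v) hr0.le]

theorem HasMatching.of_card_le {V : Type*} {G : SimpleGraph V} {m : ℕ} {M : Finset (Sym2 V)}
    (hm : m ≤ M.card) (hG : ∀ e ∈ M, e ∈ G.edgeSet)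
    (hM : ∀ e ∈ M, ∀ f ∈ M, e ≠ f → ∀ v : V, ¬(v ∈ e ∧ v ∈ f)) : HasMatching G m := by
  obtain ⟨M', hsub, hcard⟩ := Finset.exists_subset_card_eq hm
  exact ⟨M', hcard, fun e he => hG e (hsub he), fun e he f hf => hM e (hsub he) f (hsub hf)⟩

/-- The graph obtained from `G` by adding `d` new vertices adjacent to everything. -/
def joinUniversal {V : Type*} (G : SimpleGraph V) (d : ℕ) : SimpleGraph (V ⊕ Fin d) where
  Adj a b := a ≠ b ∧ ∀ v w, a = Sum.inl v → b = Sum.inl w → G.Adj v w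
  symm := ⟨fun _ _ h => ⟨h.1.symm, fun v w hv hw => (h.2 w v hw hv).symm⟩⟩
  loopless := ⟨fun _ h => h.1 rfl⟩

theorem hasMatching_of_isPerfectMatching_joinUniversal {V : Type*} [Fintype V]
    {G : SimpleGraph V} {d m : ℕ} (hm : 2 * m + d ≤ Fintype.card V + 1)
    {M : (joinUniversal G d).Subgraph} (hM : M.IsPerfectMatching) : HasMatching G m := by
  classical
  choose p hp hpu using fun a => hM.1 (hM.2 a)
  have hpp : ∀ a, p (p a) = a := fun a => (hpu _ _ (hp a).symm).symm
  have hinj : Function.Injective p := fun a b h => by rw [← hpp a, h, hpp]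
  let T : Finset V := Finset.univ.filter fun v => ∃ w, p (Sum.inl v) = Sum.inl w
  have hT : Fintype.card V ≤ T.card + d := by
    have h1 : (Finset.univ.filter fun v : V => ¬ ∃ w, p (Sum.inl v) = Sum.inl w).card ≤ d := by
      have h2 : ∀ v : V, (¬ ∃ w, p (Sum.inl v) = Sum.inl w) → ∃ j, p (Sum.inl v) = Sum.inr j := by
        intro v hv
        rcases hc : p (Sum.inl v) with w | j
        · exact absurd ⟨w, hc⟩ hv
        · exact ⟨j, rfl⟩
      calc _ ≤ (Finset.univ.image (Sum.inr : Fin d → V ⊕ Fin d)).card := by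
            refine Finset.card_le_card_of_injOn (fun v => p (Sum.inl v)) (fun v hv => ?_)
              (fun a _ b _ h => Sum.inl_injective (hinj h))
            obtain ⟨j, hj⟩ := h2 v (by simpa using hv)
            simp [hj]
        _ ≤ d := Finset.card_image_le.trans (by simp)
    have h3 := Finset.card_filter_add_card_filter_not (s := (Finset.univ : Finset V))
      (fun v => ∃ w, p (Sum.inl v) = Sum.inl w)
    rw [Finset.card_univ] at h3
    change _ ≤ (Finset.univ.filter fun v : V => ∃ w, p (Sum.inl v) = Sum.inl w).card + d
    omega
  let q : V → V := fun v => Sum.elim id (fun _ => v) (p (Sum.inl v))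
  have hq : ∀ v ∈ T, p (Sum.inl v) = Sum.inl (q v) := by
    intro v hv
    obtain ⟨w, hw⟩ := (Finset.mem_filter.1 hv).2
    simp [q, hw]
  have hqT : ∀ v ∈ T, q v ∈ T := fun v hv =>
    Finset.mem_filter.2 ⟨Finset.mem_univ _, v, by rw [← hq v hv, hpp]⟩
  have hqq : ∀ v ∈ T, q (q v) = v := fun v hv => by
    have h1 := hq _ (hqT v hv)
    rw [← hq v hv, hpp] at h1
    exact (Sum.inl_injective h1).symm
  have hpair : ∀ v ∈ T, ∀ u ∈ s(v, q v), s(v, q v) = s(u, q u) := by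
    intro v hv u hu
    rcases Sym2.mem_iff.1 hu with rfl | rfl
    · rfl
    · rw [hqq v hv, Sym2.eq_swap]
  have hcard : T.card ≤ 2 * (T.image fun v => s(v, q v)).card := by
    refine Finset.card_le_mul_card_image T 2 fun e he => ?_
    obtain ⟨v, hv, rfl⟩ := Finset.mem_image.1 he
    refine (Finset.card_le_card (t := {v, q v}) fun u hu => ?_).trans Finset.card_le_two
    have h1 : u ∈ s(u, q u) := Sym2.mem_mk_left _ _
    rw [(Finset.mem_filter.1 hu).2] at h1
    simpa using h1
  refine HasMatching.of_card_le (M := T.image fun v => s(v, q v)) (by omega) ?_ ?_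
  · intro e he
    obtain ⟨v, hv, rfl⟩ := Finset.mem_image.1 he
    exact (hp (Sum.inl v)).adj_sub.2 v (q v) rfl (hq v hv)
  · intro e he f hf hne u hu
    obtain ⟨v, hv, rfl⟩ := Finset.mem_image.1 he
    obtain ⟨w, hw, rfl⟩ := Finset.mem_image.1 hf
    exact hne ((hpair v hv u hu.1).trans (hpair w hw u hu.2).symm)

/-- The nontrivial direction of the Tutte–Berge formula: if `G` has no `k + 1` disjoint edges, some
vertex set `S` separates `G` into pieces (the colour classes of `c`) with
`|S| + ∑ ⌊|piece| / 2⌋ ≤ k`. -/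
theorem exists_separator_of_not_hasMatching {V : Type} [Fintype V] [DecidableEq V]
    {G : SimpleGraph V} {k : ℕ} (hk : 2 * k + 2 ≤ Fintype.card V) (hG : ¬ HasMatching G (k + 1)) :
    ∃ (S : Finset V) (ι : Type) (_ : Fintype ι) (_ : DecidableEq ι) (c : V → ι),
      (∀ v w, v ∉ S → w ∉ S → G.Adj v w → c v = c w) ∧
      S.card + ∑ i, (Finset.univ.filter fun v => v ∉ S ∧ c v = i).card / 2 ≤ k := by
  classical
  obtain ⟨d, hd⟩ := Nat.exists_eq_add_of_le hk
  have hno : ∀ M : (joinUniversal G d).Subgraph, ¬ M.IsPerfectMatching := fun M hM =>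
    hG (hasMatching_of_isPerfectMatching_joinUniversal (by omega) hM)
  have htutte := mt SimpleGraph.tutte.2 (by simpa using hno)
  push Not at htutte
  obtain ⟨U, hU⟩ := htutte
  rw [SimpleGraph.IsTutteViolator] at hU
  set K := ((⊤ : (joinUniversal G d).Subgraph).deleteVerts U).coe with hK
  have hmem : ∀ a, a ∈ ((⊤ : (joinUniversal G d).Subgraph).deleteVerts U).verts ↔ a ∉ U := by
    simp
  have hKadj : ∀ a b, K.Adj a b ↔ (joinUniversal G d).Adj a.1 b.1 := by
    rintro ⟨a, ha⟩ ⟨b, hb⟩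
    rw [hmem] at ha hb
    simp [hK, ha, hb]
  have hinr : ∀ j, Sum.inr j ∈ U := by
    by_contra! hj
    obtain ⟨j, hj⟩ := hj
    have hsub : Subsingleton K.ConnectedComponent := by
      have h1 : ∀ a, K.Reachable a ⟨Sum.inr j, (hmem _).2 hj⟩ := by
        intro a
        by_cases ha : a.1 = Sum.inr j
        · rw [Subtype.ext (a1 := a) (a2 := ⟨Sum.inr j, (hmem _).2 hj⟩) ha]
        · exact SimpleGraph.Adj.reachable ((hKadj _ _).2 ⟨ha, fun v w _ h => by simp at h⟩)
      refine ⟨fun x y => ?_⟩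
      induction x using SimpleGraph.ConnectedComponent.ind with | _ a =>
      induction y using SimpleGraph.ConnectedComponent.ind with | _ b =>
      exact SimpleGraph.ConnectedComponent.sound ((h1 a).trans (h1 b).symm)
    have hle : K.oddComponents.ncard ≤ 1 := Set.ncard_le_one_of_subsingleton _
    have hU0 : U = ∅ := (Set.ncard_eq_zero (Set.toFinite U)).1 (by omega)
    have hone : K.oddComponents.ncard = 1 := by omega
    have hodd := (SimpleGraph.odd_ncard_oddComponents (G := K)).1 (hone ▸ odd_one)
    have hcard : Nat.card ((⊤ : (joinUniversal G d).Subgraph).deleteVerts U).verts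
        = Fintype.card V + d := by
      rw [Nat.card_congr (Equiv.subtypeUnivEquiv fun a => (hmem a).2 (by simp [hU0]))]
      simp
    rw [hcard, hd] at hodd
    obtain ⟨r, hr⟩ := hodd
    omega
  let S : Finset V := Finset.univ.filter fun v => Sum.inl v ∈ U
  have hS : ∀ v, v ∈ S ↔ Sum.inl v ∈ U := by simp [S]
  have hUcard : U.ncard = S.card + d := by
    have h1 : U = ((S.disjSum (Finset.univ : Finset (Fin d)) : Finset (V ⊕ Fin d)) : Set _) := by
      ext a
      rcases a with v | j
      · simp [hS]
      · simp [hinr]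
    rw [h1, Set.ncard_coe_finset, Finset.card_disjSum, Finset.card_univ, Fintype.card_fin]
  let c : V → Option K.ConnectedComponent := fun v =>
    if h : v ∉ S then some (K.connectedComponentMk ⟨Sum.inl v, (hmem _).2 (mt (hS v).2 h)⟩) else none
  have hc : ∀ v (h : v ∉ S),
      c v = some (K.connectedComponentMk ⟨Sum.inl v, (hmem _).2 (mt (hS v).2 h)⟩) :=
    fun v h => dif_pos h
  let t : Option K.ConnectedComponent → ℕ :=
    fun i => (Finset.univ.filter fun v => v ∉ S ∧ c v = i).card
  have hsum : ∑ i, t i + S.card = Fintype.card V := by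
    have h1 := Finset.card_eq_sum_card_fiberwise (f := c) (s := Sᶜ) (t := Finset.univ)
      (fun _ _ => Finset.mem_coe.2 (Finset.mem_univ _))
    have h2 : ∑ i, t i = Sᶜ.card := by
      rw [h1]
      refine Finset.sum_congr rfl fun i _ => congrArg Finset.card ?_
      ext v
      simp
    rw [h2, add_comm, Finset.card_add_card_compl]
  have hsupp : ∀ C : K.ConnectedComponent, C.supp.ncard = t (some C) := by
    intro C
    change C.supp.ncard = (Finset.univ.filter fun v => v ∉ S ∧ c v = some C).card
    rw [← Set.ncard_coe_finset]
    symm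
    refine Set.ncard_congr (fun v hv => ⟨Sum.inl v, (hmem _).2 (mt (hS v).2 ?_)⟩) ?_ ?_ ?_
    · simp only [Finset.coe_filter, Set.mem_ofPred_eq] at hv
      exact hv.2.1
    · intro v hv
      simp only [Finset.coe_filter, Set.mem_ofPred_eq] at hv
      have h1 := hv.2.2
      rw [hc v hv.2.1] at h1
      exact Option.some_injective _ h1
    · intro v w _ _ h
      exact Sum.inl_injective (congrArg Subtype.val h)
    · rintro ⟨v | j, ha⟩ hC
      · have h1 : v ∉ S := mt (hS v).1 ((hmem _).1 ha)
        refine ⟨v, ?_, rfl⟩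
        simp only [Finset.coe_filter, Set.mem_ofPred_eq]
        exact ⟨Finset.mem_univ _, h1, by rw [hc v h1]; exact congrArg some hC⟩
      · exact absurd (hinr j) ((hmem _).1 ha)
  have hodd : K.oddComponents.ncard ≤ ∑ i, t i % 2 := by
    have h1 : K.oddComponents.ncard ≤ ∑ C : K.ConnectedComponent, t (some C) % 2 := by
      rw [Set.ncard_eq_toFinset_card', Finset.card_eq_sum_ones]
      refine (Finset.sum_le_sum fun C hC => ?_).trans
        (Finset.sum_le_sum_of_subset (Finset.subset_univ _))
      have h2 : Odd C.supp.ncard := by simpa using hC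
      rw [hsupp, Nat.odd_iff] at h2
      omega
    rw [Fintype.sum_option]
    omega
  have hsplit : ∑ i, t i = 2 * ∑ i, t i / 2 + ∑ i, t i % 2 := by
    rw [Finset.mul_sum, ← Finset.sum_add_distrib]
    exact Finset.sum_congr rfl fun i _ => (Nat.div_add_mod _ _).symm
  refine ⟨S, Option K.ConnectedComponent, inferInstance, inferInstance, c, ?_, ?_⟩
  · intro v w hv hw hvw
    rw [hc v hv, hc w hw, Option.some_inj]
    refine SimpleGraph.ConnectedComponent.sound (SimpleGraph.Adj.reachable ((hKadj _ _).2 ?_))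
    refine ⟨fun h => hvw.ne (Sum.inl_injective h), fun a b ha hb => ?_⟩
    rw [← Sum.inl_injective ha, ← Sum.inl_injective hb]
    exact hvw
  · change S.card + ∑ i, t i / 2 ≤ k
    omega

/-- The larger root of the characteristic polynomial of the quotient matrix of `S_{n,k}`. -/
theorem exists_root_gt {k n : ℕ} (hk : 1 ≤ k) (hn : 5 * k + 3 < 2 * n) :
    ∃ ρ : ℝ, 4 * k < ρ ∧ ρ ^ 2 - (n + 2 * k - 2) * ρ + 2 * k * (k - 1) = 0 := by
  have hk' : (1 : ℝ) ≤ k := by exact_mod_cast hk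
  have hn' : (5 * k + 3 : ℝ) < 2 * n := by exact_mod_cast hn
  set f : ℝ → ℝ := fun t => t ^ 2 - (n + 2 * k - 2) * t + 2 * k * (k - 1) with hf
  have h4 : f (4 * k) < 0 := by simp only [hf]; nlinarith
  have hb : 0 ≤ f (n + 6 * k) := by simp only [hf]; nlinarith
  obtain ⟨ρ, hρ, h0⟩ := intermediate_value_Icc (f := f) (a := 4 * (k : ℝ)) (b := n + 6 * k)
    (by linarith) (by fun_prop) ⟨h4.le, hb⟩
  refine ⟨ρ, lt_of_le_of_ne hρ.1 fun h => ?_, h0⟩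
  rw [← h] at h0
  linarith

/-- The vector taking the value `1` on `S` and `k / (ρ - k)` off `S` is an eigenvector of the join
of a clique on `S` with an independent set. -/
theorem sum_split_vector_eq {V : Type*} [Fintype V] [DecidableEq V] {S : Finset V} {k : ℕ}
    (hk : 1 ≤ k) (hS : S.card = k) {ρ : ℝ} (hρk : 4 * k < ρ)
    (hρ : ρ ^ 2 - (Fintype.card V + 2 * k - 2) * ρ + 2 * k * (k - 1) = 0) {x : V → ℝ}
    (hx : x = fun v => if v ∈ S then 1 else k / (ρ - k)) (v : V) :
    (∑ w, if v ≠ w ∧ (v ∈ S ∨ w ∈ S) then x v + x w else 0) = ρ * x v := by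
  have hk' : (1 : ℝ) ≤ k := by exact_mod_cast hk
  have hne : ρ - k ≠ 0 := by intro h; linarith
  have hx1 : ∀ w ∈ S, x w = 1 := fun w hw => by simp [hx, hw]
  have hx2 : ∀ w ∉ S, x w = k / (ρ - k) := fun w hw => by simp [hx, hw]
  by_cases hv : v ∈ S
  · have h1 : (∑ w, if v ≠ w ∧ (v ∈ S ∨ w ∈ S) then x v + x w else 0)
        = ∑ w, ((1 + x w) - if v = w then 2 else 0) := by
      refine Finset.sum_congr rfl fun w _ => ?_
      by_cases h : v = w
      · subst h
        simp [hx1 v hv]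
        norm_num
      · simp [h, hv, hx1 v hv]
    have h2 : ∑ w, x w = k + (Fintype.card V - k) * (k / (ρ - k)) := by
      rw [← Finset.sum_add_sum_compl S x, Finset.sum_congr rfl hx1,
        Finset.sum_congr rfl (fun w hw => hx2 w (Finset.mem_compl.1 hw))]
      simp only [Finset.sum_const, nsmul_eq_mul, mul_one, hS]
      rw [Finset.card_compl, Nat.cast_sub (Finset.card_le_univ S), hS]
    rw [h1, Finset.sum_sub_distrib, Finset.sum_add_distrib, h2, hx1 v hv]
    simp only [Finset.sum_const, Finset.card_univ, nsmul_eq_mul, Finset.sum_ite_eq,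
      Finset.mem_univ, if_true]
    field_simp
    linarith
  · have h1 : (∑ w, if v ≠ w ∧ (v ∈ S ∨ w ∈ S) then x v + x w else 0)
        = ∑ w ∈ S, (k / (ρ - k) + 1) := by
      rw [← Finset.sum_filter]
      have h2 : (Finset.univ.filter fun w => v ≠ w ∧ (v ∈ S ∨ w ∈ S)) = S := by
        ext w
        simp only [Finset.mem_filter, Finset.mem_univ, true_and, hv, false_or]
        exact ⟨fun h => h.2, fun h => ⟨fun e => hv (e ▸ h), h⟩⟩
      rw [h2]
      exact Finset.sum_congr rfl fun w hw => by rw [hx1 w hw, hx2 v hv]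
    rw [h1, hx2 v hv, Finset.sum_const, nsmul_eq_mul, hS]
    field_simp
    ring

theorem Snk_adj {n k : ℕ} (i j : Fin n) :
    (Snk n k).Adj i j ↔ i ≠ j ∧ ((i : ℕ) < k ∨ (j : ℕ) < k) := by
  simp only [Snk, SimpleGraph.fromRel_adj]
  tauto

theorem card_filter_val_lt {n k : ℕ} (hkn : k ≤ n) :
    (Finset.univ.filter fun i : Fin n => (i : ℕ) < k).card = k := by
  rw [Fin.card_filter_val_lt, min_eq_right hkn]

theorem le_qIndex_Snk {n k : ℕ} (hk : 1 ≤ k) (hkn : k ≤ n) {ρ : ℝ} (hρk : 4 * k < ρ)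
    (hρ : ρ ^ 2 - (n + 2 * k - 2) * ρ + 2 * k * (k - 1) = 0) : ρ ≤ qIndex (Snk n k) := by
  classical
  set S : Finset (Fin n) := Finset.univ.filter fun i => (i : ℕ) < k with hS
  have hcard : S.card = k := card_filter_val_lt hkn
  set x : Fin n → ℝ := fun v => if v ∈ S then 1 else k / (ρ - k) with hx
  refine le_qIndex_of_mulVec_eq (x := x) (fun h => ?_) (funext fun v => ?_)
  · obtain ⟨v, hv⟩ := Finset.card_pos.1 (by omega : 0 < S.card)
    have := congrFun h v
    simp [hx, hv] at this
  · rw [signlessLaplacian_mulVec_apply, Pi.smul_apply, smul_eq_mul,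
      ← sum_split_vector_eq hk hcard hρk (by simpa using hρ) hx v]
    refine Finset.sum_congr rfl fun w _ => if_congr ?_ rfl rfl
    simp [Snk_adj, hS]

/-- A proper subgraph of the join of a clique on `S` with an independent set has smaller
`Q`-index. -/
theorem qIndex_lt_of_isVertexCover {V : Type*} [Fintype V] [DecidableEq V] {G : SimpleGraph V}
    {S : Finset V} {k : ℕ} (hk : 1 ≤ k) (hS : S.card = k) {ρ : ℝ} (hρk : 4 * k < ρ)
    (hρ : ρ ^ 2 - (Fintype.card V + 2 * k - 2) * ρ + 2 * k * (k - 1) = 0)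
    (hcover : ∀ v w, G.Adj v w → v ∈ S ∨ w ∈ S) {u u' : V} (hu : u ∈ S) (hne : u ≠ u')
    (huu' : ¬ G.Adj u u') : qIndex G < ρ := by
  classical
  have hk' : (1 : ℝ) ≤ k := by exact_mod_cast hk
  obtain ⟨x, hx⟩ : ∃ x : V → ℝ, x = fun v => if v ∈ S then 1 else k / (ρ - k) := ⟨_, rfl⟩
  have hpos : ∀ v, 0 < x v := fun v => by
    simp only [hx]
    split_ifs
    · exact one_pos
    · exact div_pos (by linarith) (by linarith)
  have hterm : ∀ v w, (if G.Adj v w then x v + x w else 0)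
      ≤ if v ≠ w ∧ (v ∈ S ∨ w ∈ S) then x v + x w else 0 := by
    intro v w
    by_cases h : G.Adj v w
    · rw [if_pos h, if_pos ⟨h.ne, hcover v w h⟩]
    · rw [if_neg h]
      split_ifs
      exacts [(add_pos (hpos v) (hpos w)).le, le_rfl]
  have hstrict : ∀ v w, v ≠ w → (v ∈ S ∨ w ∈ S) → ¬ G.Adj v w →
      (signlessLaplacian G *ᵥ x) v < ρ * x v := by
    intro v w hvw hS' hadj
    rw [signlessLaplacian_mulVec_apply, ← sum_split_vector_eq hk hS hρk hρ hx v]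
    refine Finset.sum_lt_sum (fun w _ => hterm v w) ⟨w, Finset.mem_univ _, ?_⟩
    rw [if_neg hadj, if_pos ⟨hvw, hS'⟩]
    exact add_pos (hpos v) (hpos w)
  refine qIndex_lt_of_mulVec_le (x := x) (u := u) hpos (fun v => ?_) fun v => ?_
  · rw [signlessLaplacian_mulVec_apply, ← sum_split_vector_eq hk hS hρk hρ hx v]
    exact Finset.sum_le_sum fun w _ => hterm v w
  · by_cases hvu : v = u
    · subst hvu
      exact Or.inr (hstrict v u' hne (Or.inl hu) huu')
    · exact or_iff_not_imp_left.2 (hstrict v u hvu (Or.inr hu))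

theorem nonempty_iso_Snk {n k : ℕ} (hkn : k ≤ n) {G : SimpleGraph (Fin n)} {S : Finset (Fin n)}
    (hS : S.card = k) (hG : ∀ v w, G.Adj v w ↔ v ≠ w ∧ (v ∈ S ∨ w ∈ S)) :
    Nonempty (G ≃g Snk n k) := by
  have hcard : Fintype.card {v // v ∈ S} = Fintype.card {i : Fin n // (i : ℕ) < k} := by
    rw [Fintype.card_coe, Fintype.card_subtype, hS, card_filter_val_lt hkn]
  have e := Fintype.equivOfCardEq hcard
  have he : ∀ v, (e.extendSubtype v : ℕ) < k ↔ v ∈ S := fun v =>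
    ⟨fun h => by_contra fun hv => e.extendSubtype_not_mem v hv h, e.extendSubtype_mem v⟩
  exact ⟨⟨e.extendSubtype, fun {v w} => by simp [Snk_adj, hG, he]⟩⟩

/-- Convexity of `t ↦ t / (A - 2 (t - 1))`, in the form of a bound linear in `⌊t / 2⌋`. -/
theorem div_sub_le_of_le {A m : ℝ} {t : ℕ} (hA : 4 * m < A) (hm : 0 ≤ m)
    (ht : ((t / 2 : ℕ) : ℝ) ≤ m) :
    t * (1 / (A - 2 * (t - 1))) ≤
      t / A + ((t / 2 : ℕ) : ℝ) * (4 * (2 * m + 1) / (A * (A - 4 * m))) := by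
  have hA0 : 0 < A := by linarith
  rcases Nat.eq_zero_or_pos t with rfl | hpos
  · simp
  have ht1 : (1 : ℝ) ≤ t := by exact_mod_cast hpos
  set e : ℝ := ((t / 2 : ℕ) : ℝ) with he
  have hte : (t : ℝ) ≤ 2 * e + 1 := by
    rw [he]
    exact_mod_cast (by omega : t ≤ 2 * (t / 2) + 1)
  have hden : 0 < A - 2 * (t - 1) := by linarith
  have hsplit : (t : ℝ) * (1 / (A - 2 * (t - 1)))
      = t / A + 2 * t * (t - 1) / (A * (A - 2 * (t - 1))) := by
    field_simp
    ring
  rw [hsplit, ← mul_div_assoc]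
  have hA4 : 0 < A - 4 * m := by linarith
  have he0 : 0 ≤ e := Nat.cast_nonneg _
  gcongr t / A + ?_ / (A * ?_)
  · nlinarith [mul_le_mul (by linarith : (t : ℝ) - 1 ≤ 2 * e) (by linarith : (t : ℝ) ≤ 2 * m + 1)
      (by linarith) (by linarith)]
  · linarith

theorem separator_inequality {k s n ρ : ℝ} (hk : 1 ≤ k) (hs : 0 ≤ s) (hsk : s < k)
    (hρk : 4 * k < ρ) (hρ : ρ ^ 2 - (n + 2 * k - 2) * ρ + 2 * k * (k - 1) = 0) :
    s * ((n - s) / (ρ - s) + (k - s) * (4 * (2 * (k - s) + 1) /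
      ((ρ - s) * (ρ - s - 4 * (k - s))))) < ρ - n - s + 2 := by
  have hρ0 : 0 < ρ := by linarith
  have hA : 0 < ρ - s := by linarith
  have hB : 0 < ρ - s - 4 * (k - s) := by linarith
  have hn : n = ρ - 2 * k + 2 + 2 * k * (k - 1) / ρ := by
    field_simp
    linarith
  have hkey : 0 < (ρ - s - k + 1) * (ρ - s - 4 * (k - s)) - 2 * s * (2 * (k - s) + 1) := by
    nlinarith [mul_nonneg hs hs, mul_pos (by linarith : 0 < ρ - 4 * k) (by linarith : 0 < ρ - s - k + 1),
      mul_nonneg hs (by linarith : 0 ≤ ρ - 4 * k), mul_nonneg hs (by linarith : 0 ≤ k - s)]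
  have hdiff : ρ - n - s + 2 - s * ((n - s) / (ρ - s) + (k - s) * (4 * (2 * (k - s) + 1) /
      ((ρ - s) * (ρ - s - 4 * (k - s)))))
      = 2 * (k - s) / ((ρ - s) * (ρ - s - 4 * (k - s))) *
        ((ρ - s - k + 1) * (ρ - s - 4 * (k - s)) - 2 * s * (2 * (k - s) + 1)) := by
    obtain ⟨D, hD⟩ : ∃ D, ρ - s - 4 * (k - s) = D := ⟨_, rfl⟩
    rw [hD] at hB ⊢
    rw [hn]
    field_simp
    rw [← hD]
    ring
  rw [← sub_pos, hdiff]
  have : 0 < k - s := by linarith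
  positivity

theorem qIndex_lt_of_separator {V ι : Type*} [Fintype V] [DecidableEq V] [Fintype ι]
    [DecidableEq ι] {G : SimpleGraph V} {S : Finset V} {c : V → ι} {k : ℕ}
    (hSk : S.card < k) (hV : k ≤ Fintype.card V) {ρ : ℝ} (hρk : 4 * k < ρ)
    (hρ : ρ ^ 2 - (Fintype.card V + 2 * k - 2) * ρ + 2 * k * (k - 1) = 0)
    (hc : ∀ v w, v ∉ S → w ∉ S → G.Adj v w → c v = c w)
    (hsum : S.card + ∑ i, (Finset.univ.filter fun v => v ∉ S ∧ c v = i).card / 2 ≤ k) :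
    qIndex G < ρ := by
  classical
  set s : ℝ := (S.card : ℝ) with hs
  have hs0 : 0 ≤ s := Nat.cast_nonneg _
  have hsk : s < k := Nat.cast_lt.2 hSk
  have hk1 : (1 : ℝ) ≤ k := by exact_mod_cast (by omega : 1 ≤ k)
  have hkV : (k : ℝ) ≤ Fintype.card V := by exact_mod_cast hV
  let t : ι → ℕ := fun i => (Finset.univ.filter fun v => v ∉ S ∧ c v = i).card
  have hhalf : ((∑ i, t i / 2 : ℕ) : ℝ) ≤ k - s := by
    rw [le_sub_iff_add_le', hs]
    exact_mod_cast hsum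
  have hti : ∀ i, ((t i / 2 : ℕ) : ℝ) ≤ k - s := fun i => by
    refine le_trans ?_ hhalf
    exact_mod_cast Finset.single_le_sum (f := fun i => t i / 2) (fun _ _ => Nat.zero_le _)
      (Finset.mem_univ i)
  have hfiber : ∀ f : ι → ℝ, ∑ v ∈ Sᶜ, f (c v) = ∑ i, t i * f i := by
    intro f
    rw [← Finset.sum_fiberwise_of_maps_to (s := Sᶜ) (t := Finset.univ) (g := c)
      (fun _ _ => Finset.mem_univ _)]
    refine Finset.sum_congr rfl fun i _ => ?_
    rw [Finset.sum_congr rfl (fun v hv => by rw [(Finset.mem_filter.1 hv).2] : ∀ v ∈ Sᶜ.filter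
      (fun v => c v = i), f (c v) = f i), Finset.sum_const, nsmul_eq_mul]
    congr 3
    ext v
    simp
  have htotal : ∑ i, (t i : ℝ) = Fintype.card V - s := by
    have h1 := hfiber fun _ => 1
    simp only [Finset.sum_const, nsmul_eq_mul, mul_one] at h1
    rw [← h1, Finset.card_compl, Nat.cast_sub (Finset.card_le_univ S)]
  set A := ρ - s with hA
  have hAm : 4 * (k - s) < A := by linarith
  set B := (Fintype.card V - s) / A + (k - s) * (4 * (2 * (k - s) + 1) / (A * (A - 4 * (k - s))))
    with hB
  have hden : ∀ i, 0 < A - 2 * (t i - 1) := fun i => by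
    have h1 : (t i : ℝ) ≤ 2 * ((t i / 2 : ℕ) : ℝ) + 1 := by
      exact_mod_cast (by omega : t i ≤ 2 * (t i / 2) + 1)
    linarith [hti i]
  have hcoef : 0 ≤ 4 * (2 * (k - s) + 1) / (A * (A - 4 * (k - s))) :=
    div_nonneg (by linarith) (mul_nonneg (by linarith) (by linarith))
  have hsumB : ∑ v ∈ Sᶜ, 1 / (A - 2 * (t (c v) - 1)) ≤ B := by
    rw [hfiber fun i => 1 / (A - 2 * (t i - 1))]
    calc _ ≤ ∑ i, ((t i : ℝ) / A +
          ((t i / 2 : ℕ) : ℝ) * (4 * (2 * (k - s) + 1) / (A * (A - 4 * (k - s))))) :=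
          Finset.sum_le_sum fun i _ => div_sub_le_of_le hAm (by linarith) (hti i)
      _ ≤ B := by
          rw [Finset.sum_add_distrib, ← Finset.sum_div, ← Finset.sum_mul, htotal, hB,
            ← Nat.cast_sum]
          gcongr
  have hBpos : 0 < B := by
    have h1 : 0 < (Fintype.card V - s) / A := div_pos (by linarith) (by linarith)
    have h2 : 0 ≤ (k - s) * (4 * (2 * (k - s) + 1) / (A * (A - 4 * (k - s)))) :=
      mul_nonneg (by linarith) hcoef
    linarith
  have hineq : s * B < ρ - Fintype.card V - s + 2 := separator_inequality hk1 hs0 hsk hρk hρ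
  obtain ⟨s', hss', hs'⟩ := exists_between ((lt_div_iff₀ hBpos).2 hineq)
  rw [lt_div_iff₀ hBpos] at hs'
  have hs'0 : 0 < s' := hs0.trans_lt hss'
  obtain ⟨x, hx⟩ : ∃ x : V → ℝ,
      x = fun v => if v ∈ S then 1 else s' * (1 / (A - 2 * (t (c v) - 1))) := ⟨_, rfl⟩
  have hx1 : ∀ v ∈ S, x v = 1 := fun v hv => by simp [hx, hv]
  have hx2 : ∀ v ∉ S, x v = s' * (1 / (A - 2 * (t (c v) - 1))) := fun v hv => by simp [hx, hv]
  have hpos : ∀ v, 0 < x v := fun v => by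
    by_cases hv : v ∈ S
    · rw [hx1 v hv]; exact one_pos
    · rw [hx2 v hv]; exact mul_pos hs'0 (one_div_pos.2 (hden _))
  have hrow : ∀ v, (signlessLaplacian G *ᵥ x) v < ρ * x v := by
    intro v
    rw [signlessLaplacian_mulVec_apply]
    by_cases hv : v ∈ S
    · calc _ ≤ ∑ w, ((1 + x w) - if v = w then 2 else 0) := by
            refine Finset.sum_le_sum fun w _ => ?_
            by_cases h : v = w
            · subst h
              simp [hx1 v hv]
              norm_num
            · rw [if_neg h, hx1 v hv]
              split_ifs <;> linarith [hpos w]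
        _ = Fintype.card V + s + ∑ w ∈ Sᶜ, x w - 2 := by
            rw [Finset.sum_sub_distrib, Finset.sum_add_distrib, ← Finset.sum_add_sum_compl S x,
              Finset.sum_congr rfl hx1]
            simp only [Finset.sum_const, Finset.card_univ, nsmul_eq_mul, Finset.sum_ite_eq,
              Finset.mem_univ, if_true, hs]
            ring
        _ ≤ Fintype.card V + s + s' * B - 2 := by
            rw [Finset.sum_congr rfl (fun w hw => hx2 w (Finset.mem_compl.1 hw)), ← Finset.mul_sum]
            gcongr
        _ < ρ * x v := by
            rw [hx1 v hv]
            linarith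
    · set F := (Finset.univ.filter fun w => w ∉ S ∧ c w = c v).erase v with hF
      have hvF : v ∈ Finset.univ.filter fun w => w ∉ S ∧ c w = c v := by simp [hv]
      have hFcard : (F.card : ℝ) = t (c v) - 1 := by
        rw [hF, Finset.card_erase_of_mem hvF, Nat.cast_sub (Finset.card_pos.2 ⟨v, hvF⟩),
          Nat.cast_one]
      have hdisj : Disjoint S F := Finset.disjoint_left.2 fun w hw hwF => by simp [hF, hw] at hwF
      calc _ ≤ ∑ w ∈ S ∪ F, (x v + x w) := by
            rw [← Finset.sum_filter]
            refine Finset.sum_le_sum_of_subset_of_nonneg (fun w hw => ?_)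
              fun w _ _ => (add_pos (hpos v) (hpos w)).le
            have hvw : G.Adj v w := (Finset.mem_filter.1 hw).2
            by_cases hwS : w ∈ S
            · exact Finset.mem_union_left _ hwS
            · refine Finset.mem_union_right _ (Finset.mem_erase.2 ⟨hvw.ne', ?_⟩)
              simp [hwS, hc v w hv hwS hvw]
        _ = s * (x v + 1) + (t (c v) - 1) * (x v + x v) := by
            rw [Finset.sum_union hdisj,
              Finset.sum_congr rfl (fun w hw => by rw [hx1 w hw] : ∀ w ∈ S, x v + x w = x v + 1),
              Finset.sum_congr rfl (fun w hw => ?_ : ∀ w ∈ F, x v + x w = x v + x v),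
              Finset.sum_const, Finset.sum_const, nsmul_eq_mul, nsmul_eq_mul, hFcard]
            obtain ⟨-, hwS, hcw⟩ : w ≠ v ∧ w ∉ S ∧ c w = c v := by simpa [hF] using hw
            rw [hx2 w hwS, hx2 v hv, hcw]
        _ < ρ * x v := by
            have h1 : x v * (A - 2 * (t (c v) - 1)) = s' := by
              rw [hx2 v hv, mul_assoc, one_div, inv_mul_cancel₀ (hden _).ne', mul_one]
            rw [hA] at h1
            linarith
  have hVpos : 0 < Fintype.card V := by omega
  obtain ⟨u⟩ := Fintype.card_pos_iff.1 hVpos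
  exact qIndex_lt_of_mulVec_le (u := u) hpos (fun v => (hrow v).le) fun v => Or.inr (hrow v)

/-- Yu (iii): if `k ≥ 1`, `n > (5k+3)/2` and `q(G) ≥ q(S_{n,k})`, then `G` contains
a matching of `k+1` edges unless `G ≅ S_{n,k}`. -/
theorem stmt_16 (k n : ℕ) (hk : 1 ≤ k) (hn : 5 * k + 3 < 2 * n) (G : SimpleGraph (Fin n))
    (hq : qIndex (Snk n k) ≤ qIndex G) :
    HasMatching G (k + 1) ∨ Nonempty (G ≃g Snk n k) := by 
  classical
  by_contra! hcon
  obtain ⟨hM, hiso⟩ := hcon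
  obtain ⟨ρ, hρk, hρ⟩ := exists_root_gt hk hn
  have hρq : ρ ≤ qIndex G := (le_qIndex_Snk hk (by omega) hρk hρ).trans hq
  have hρ' : ρ ^ 2 - (Fintype.card (Fin n) + 2 * k - 2) * ρ + 2 * k * (k - 1) = 0 := by
    simpa using hρ
  obtain ⟨S, ι, _, _, c, hc, hsum⟩ :=
    exists_separator_of_not_hasMatching (G := G) (k := k) (by rw [Fintype.card_fin]; omega) hM
  rcases lt_or_eq_of_le (by omega : S.card ≤ k) with hS | hS
  · exact (qIndex_lt_of_separator hS (by rw [Fintype.card_fin]; omega) hρk hρ' hc hsum).not_ge hρq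
  · have hcover : ∀ v w, G.Adj v w → v ∈ S ∨ w ∈ S := by
      intro v w hvw
      by_contra! h
      have h1 : 2 ≤ (Finset.univ.filter fun a => a ∉ S ∧ c a = c w).card := by
        rw [← Finset.card_pair hvw.ne]
        refine Finset.card_le_card fun a ha => ?_
        rcases Finset.mem_insert.1 ha with rfl | ha
        · simp [h.1, hc a w h.1 h.2 hvw]
        · simp [Finset.mem_singleton.1 ha, h.2]
      have h2 := Finset.single_le_sum
        (f := fun i => (Finset.univ.filter fun a => a ∉ S ∧ c a = i).card / 2)
        (fun _ _ => Nat.zero_le _) (Finset.mem_univ (c w))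
      omega
    have hfull : ∀ u w, u ∈ S → u ≠ w → G.Adj u w := fun u w hu huw => by_contra fun h =>
      (qIndex_lt_of_isVertexCover hk hS hρk hρ' hcover hu huw h).not_ge hρq
    refine hiso.elim' (nonempty_iso_Snk (by omega) hS fun v w => ⟨fun h => ⟨h.ne, hcover v w h⟩, ?_⟩).some
    rintro ⟨hne, hv | hw⟩
    · exact hfull v w hv hne
    · exact (hfull w v hw hne.symm).symm
end

section
/- Let k ≥ 2, let G be a 2-connected simple graph, and let u be a vertex of G. If every vertex w ≠ u of G has degree d(w) ≥ k, then G contains a path on min{ν(G), 2k} vertices having u as an end vertex. -/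
open Matrix BigOperators

/-- The list `l` is the vertex sequence of a path of `G` from `x` to `y`. -/
def IsListPath {V : Type*} (G : SimpleGraph V) (l : List V) (x y : V) : Prop :=
  l.head? = some x ∧ l.getLast? = some y ∧ l.IsChain G.Adj ∧ l.Nodup

namespace IsListPath

variable {V : Type*} {G : SimpleGraph V} {l m : List V} {x y z w : V}

theorem singleton (G : SimpleGraph V) (x : V) : IsListPath G [x] x x := by
  simp [IsListPath]

theorem eq_cons (h : IsListPath G l x y) : ∃ l', l = x :: l' := by
  cases l with
  | nil => simp [IsListPath] at h
  | cons a l' => exact ⟨l', by simp_all [IsListPath]⟩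

theorem head_mem (h : IsListPath G l x y) : x ∈ l := List.mem_of_head? h.1

theorem last_mem (h : IsListPath G l x y) : y ∈ l := List.mem_of_getLast? h.2.1

theorem reverse (h : IsListPath G l x y) : IsListPath G l.reverse y x := by
  obtain ⟨h1, h2, h3, h4⟩ := h
  refine ⟨by simpa using h2, by simpa using h1, ?_, by simpa using h4⟩
  rw [List.isChain_reverse]
  exact h3.imp fun _ _ hab => hab.symm

theorem append (h : IsListPath G l x y) (h' : IsListPath G m z w) (hyz : G.Adj y z)
    (hd : ∀ v ∈ l, v ∉ m) : IsListPath G (l ++ m) x w := by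
  obtain ⟨h1, h2, h3, h4⟩ := h
  obtain ⟨g1, g2, g3, g4⟩ := h'
  refine ⟨by simp [h1], by simp [g2], ?_, ?_⟩
  · rw [List.isChain_append]
    refine ⟨h3, g3, ?_⟩
    simp [h2, g1, hyz]
  · rw [List.nodup_append]
    grind

theorem cons (h : IsListPath G l x y) (hzx : G.Adj z x) (hz : z ∉ l) :
    IsListPath G (z :: l) z y := by
  have := (singleton G z).append h hzx (by simpa using hz)
  simpa using this

theorem of_append_right (h : IsListPath G (l ++ z :: m) x y) : IsListPath G (z :: m) z y := by
  obtain ⟨h1, h2, h3, h4⟩ := h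
  rw [List.isChain_append] at h3
  rw [List.nodup_append] at h4
  exact ⟨rfl, by simpa using h2, h3.2.1, h4.2.1⟩

theorem of_append_left (h : IsListPath G (l ++ z :: m) x y) : IsListPath G (l ++ [z]) x z := by
  have h' := h.reverse
  rw [List.reverse_append, List.reverse_cons, List.append_assoc] at h'
  have := (of_append_right (l := m.reverse) (m := l.reverse) (z := z) (by simpa using h')).reverse
  simpa using this

/-- The part of a path from one of its vertices on. -/
theorem drop (h : IsListPath G l x y) (hz : z ∈ l) :
    ∃ l', IsListPath G l' z y ∧ (∀ v ∈ l', v ∈ l) ∧ (z ≠ x → x ∉ l' ∧ l'.length < l.length) := by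
  obtain ⟨l1, l2, rfl⟩ := List.append_of_mem hz
  refine ⟨z :: l2, h.of_append_right, by simp +contextual, fun hzx => ?_⟩
  cases l1 with
  | nil => exact absurd (by simpa [IsListPath] using h.1) hzx
  | cons a l1 =>
    obtain rfl : a = x := by simpa using h.1
    have := h.2.2.2
    simp at this
    refine ⟨by simp; tauto, by simp⟩

/-- Two paths that share only the last vertex of one and first vertex of the other. -/
theorem glue (h : IsListPath G l x y) (h' : IsListPath G m y z)
    (hd : ∀ v ∈ l, v ∈ m → v = y) :
    ∃ q, IsListPath G q x z ∧ (∀ v, v ∈ q ↔ v ∈ l ∨ v ∈ m) ∧ q.length + 1 = l.length + m.length := by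
  obtain ⟨m', rfl⟩ := h'.eq_cons
  refine ⟨l ++ m', ?_, ?_, by simp; omega⟩
  · cases m' with
    | nil =>
      obtain rfl : y = z := by simpa using h'.2.1
      simpa using h
    | cons c m' =>
      have h3 : IsListPath G (c :: m') c z := of_append_right (l := [y]) h'
      have hyc : G.Adj y c := by have := h'.2.2.1; simp at this; exact this.1
      have hn := h'.2.2.2
      refine h.append h3 hyc fun v hv hv' => ?_
      obtain rfl := hd v hv (List.mem_cons_of_mem _ hv')
      exact (List.nodup_cons.1 hn).1 hv'
  · intro v
    have := h.last_mem
    simp only [List.mem_append, List.mem_cons]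
    constructor
    · tauto
    · rintro (h | rfl | h) <;> tauto

/-- A cycle can be read as a path starting from any of its vertices. -/
theorem rotate (h : IsListPath G l x y) (hyx : G.Adj y x) (hz : z ∈ l) :
    ∃ l' w, IsListPath G l' z w ∧ (∀ v, v ∈ l' ↔ v ∈ l) ∧ l'.length = l.length := by
  obtain ⟨l1, l2, rfl⟩ := List.append_of_mem hz
  rcases List.eq_nil_or_concat l1 with rfl | ⟨l1, c, rfl⟩
  · obtain rfl : z = x := by simpa using h.1
    exact ⟨_, y, h, by simp, rfl⟩
  · have h1 : IsListPath G (l1 ++ [c]) x c :=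
      of_append_left (m := z :: l2) (by simpa using h)
    refine ⟨(z :: l2) ++ (l1 ++ [c]), c, h.of_append_right.append h1 hyx ?_, ?_, ?_⟩
    · have := h.2.2.2
      rw [List.nodup_append] at this
      grind
    · simp; tauto
    · simp; omega

theorem exists_walk (h : IsListPath G l x y) : ∃ p : G.Walk x y, p.support = l := by
  induction l generalizing x with
  | nil => simp [IsListPath] at h
  | cons a l ih =>
    obtain rfl : a = x := by simpa using h.1
    cases l with
    | nil =>
      obtain rfl : a = y := by simpa using h.2.1
      exact ⟨.nil, rfl⟩
    | cons b l =>
      obtain ⟨p, hp⟩ := ih (of_append_right (l := [a]) h)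
      have hab : G.Adj a b := by have := h.2.2.1; simp at this; exact this.1
      exact ⟨.cons hab p, by simp [hp]⟩

theorem of_isPath {p : G.Walk x y} (hp : p.IsPath) : IsListPath G p.support x y := by
  refine ⟨?_, ?_, p.isChain_adj_support, hp.support_nodup⟩
  · rw [List.head?_eq_some_head p.support_ne_nil]; simp
  · rw [List.getLast?_eq_some_getLast p.support_ne_nil]; simp

/-- An index range of an injective sequence of consecutively adjacent vertices. -/
theorem exists_segment {p : ℕ → V} {i j : ℕ} (hij : i ≤ j)
    (hadj : ∀ r, i ≤ r → r < j → G.Adj (p r) (p (r + 1)))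
    (hinj : ∀ r s, i ≤ r → r ≤ j → i ≤ s → s ≤ j → p r = p s → r = s) :
    ∃ l, IsListPath G l (p i) (p j) ∧ l.length + i = j + 1 ∧
      ∀ v, v ∈ l ↔ ∃ r, i ≤ r ∧ r ≤ j ∧ p r = v := by
  induction j, hij using Nat.le_induction with
  | base =>
    refine ⟨[p i], singleton G _, by simp; omega, fun v => ?_⟩
    simp only [List.mem_singleton]
    exact ⟨fun h => ⟨i, le_rfl, le_rfl, h.symm⟩, fun ⟨r, h1, h2, h3⟩ => by
      rw [← h3, le_antisymm h1 h2]⟩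
  | succ j hij ih =>
    obtain ⟨l, h1, h2, h3⟩ := ih (fun r h h' => hadj r h (by omega))
      (fun r s a b c d e => hinj r s a (by omega) c (by omega) e)
    refine ⟨l ++ [p (j + 1)], h1.append (singleton G _) (hadj j hij (by omega)) ?_,
      by simp; omega, fun v => ?_⟩
    · intro v hv hv'
      obtain ⟨r, a, b, rfl⟩ := (h3 v).1 hv
      have := hinj r (j + 1) a (by omega) (by omega) le_rfl (by simpa using hv')
      omega
    · simp only [List.mem_append, h3, List.mem_singleton]
      constructor
      · rintro (⟨r, a, b, c⟩ | rfl)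
        · exact ⟨r, a, by omega, c⟩
        · exact ⟨j + 1, by omega, le_rfl, rfl⟩
      · rintro ⟨r, a, b, c⟩
        rcases Nat.lt_or_ge r (j + 1) with h | h
        · exact .inl ⟨r, a, by omega, c⟩
        · obtain rfl : r = j + 1 := by omega
          exact .inr c.symm

end IsListPath

/-- Two vertex sets are joined by a path avoiding `r` that meets each only in one end. -/
theorem exists_connecting_path {V : Type*} {G : SimpleGraph V} {r : V}
    (hr : (G.induce {w : V | w ≠ r}).Connected) (D E : Set V)
    {d e : V} (hd : d ∈ D) (hdr : d ≠ r) (he : e ∈ E) (her : e ≠ r) :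
    ∃ l x y, IsListPath G l x y ∧ x ∈ D ∧ y ∈ E ∧ r ∉ l ∧ (∀ v ∈ l, v ∈ D → v = x) ∧
      ∀ v ∈ l, v ∈ E → v = y := by
  classical
  have hex : ∃ n l x y, IsListPath G l x y ∧ x ∈ D ∧ y ∈ E ∧ r ∉ l ∧ l.length = n := by
    obtain ⟨q, hq⟩ := (hr.preconnected ⟨d, hdr⟩ ⟨e, her⟩).exists_isPath
    refine ⟨_, (q.map (SimpleGraph.Embedding.induce _).toHom).support, d, e,
      IsListPath.of_isPath (hq.map
        (SimpleGraph.Embedding.induce (G := G) {w : V | w ≠ r}).injective), hd, he, ?_, rfl⟩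
    rw [SimpleGraph.Walk.support_map, List.mem_map]
    rintro ⟨a, -, ha⟩
    exact a.2 ha
  obtain ⟨l, x, y, hl, hx, hy, hrl, hn⟩ := Nat.find_spec hex
  refine ⟨l, x, y, hl, hx, hy, hrl, fun v hv hvD => ?_, fun v hv hvE => ?_⟩
  · by_contra hne
    obtain ⟨l', h1, h2, h3⟩ := hl.drop hv
    exact Nat.find_min hex (by rw [← hn]; exact (h3 hne).2)
      ⟨l', v, y, h1, hvD, hy, fun h => hrl (h2 _ h), rfl⟩
  · by_contra hne
    obtain ⟨l', h1, h2, h3⟩ := hl.reverse.drop (List.mem_reverse.2 hv)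
    exact Nat.find_min hex (m := l'.reverse.length) (by
      rw [← hn, List.length_reverse]; simpa using (h3 hne).2)
      ⟨l'.reverse, x, v, h1.reverse, hx, hvE,
        fun h => hrl (List.mem_reverse.1 (h2 _ (List.mem_reverse.1 h))), rfl⟩

/-- A path from a set `S` to a set `T` in a 2-connected graph can be replaced by two disjoint
such paths whose end sets contain the ends of the given one. -/
theorem exists_two_disjoint_paths {V : Type*} {G : SimpleGraph V}
    (h2 : ∀ v : V, (G.induce {w : V | w ≠ v}).Connected) (T : Set V) {e e' : V}
    (heT : e ∈ T) (heT' : e' ∈ T) (hee : e' ≠ e) (R : List V) (r : V) (S : Set V)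
    (hR : IsListPath G (r :: R) r e) (hRS : ∀ v ∈ R, v ∉ S) (hr : r ∈ S)
    (hS : ∃ s ∈ S, s ≠ r) (hRT : ∀ v ∈ r :: R, v ∈ T → v = e) :
    ∃ X Y y c d, IsListPath G X r c ∧ IsListPath G Y y d ∧ y ∈ S ∧ c ∈ T ∧ d ∈ T ∧
      (∀ v ∈ X, v ∉ Y) ∧ (∀ v ∈ X, v ∈ S → v = r) ∧ (∀ v ∈ Y, v ∈ S → v = y) ∧
      (∀ v ∈ X, v ∈ T → v = c) ∧ (∀ v ∈ Y, v ∈ T → v = d) ∧ (c = e ∨ d = e) := by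
  induction R generalizing r S with
  | nil =>
    obtain rfl : r = e := by simpa using hR.2.1
    obtain ⟨s, hs, hsr⟩ := hS
    obtain ⟨Y, y, d, hY, hy, hd, hrY, hYS, hYT⟩ :=
      exists_connecting_path (h2 r) S T hs hsr heT' hee
    exact ⟨[r], Y, y, r, d, .singleton G r, hY, hy, heT, hd, by simpa using hrY,
      by simp, hYS, by simp, hYT, .inl rfl⟩
  | cons r₁ R ih =>
    have hn := hR.2.2.2
    have hadj : G.Adj r r₁ := by have := hR.2.2.1; simp at this; exact this.1
    have hR' : IsListPath G (r₁ :: R) r₁ e := IsListPath.of_append_right (l := [r]) hR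
    have hre : r ≠ e := by
      rintro rfl
      exact (List.nodup_cons.1 hn).1 hR'.last_mem
    have hrT : r ∉ T := fun h => hre (hRT r (by simp) h)
    have hr₁S : r₁ ∉ S := hRS r₁ (by simp)
    have hrr₁ : r ≠ r₁ := hadj.ne
    obtain ⟨X, Y, y, c, d, hX, hY, hy, hc, hd, hXY, hXS, hYS, hXT, hYT, hcd⟩ :=
      ih r₁ (insert r₁ S) hR'
        (by
          intro v hv hvS
          rcases hvS with rfl | hvS
          · exact (List.nodup_cons.1 (List.nodup_cons.1 hn).2).1 hv
          · exact hRS v (by simp [hv]) hvS)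
        (by simp) ⟨r, by simp [hr], hrr₁⟩ (fun v hv => hRT v (List.mem_cons_of_mem _ hv))
    have hyr₁ : y ≠ r₁ := by
      rintro rfl
      exact hXY _ hX.head_mem hY.head_mem
    have hyS : y ∈ S := hy.resolve_left hyr₁
    have hXS' : ∀ v ∈ X, v ∉ S := by
      intro v hv hvS
      have := hXS v hv (.inr hvS)
      exact hr₁S (this ▸ hvS)
    have hrX : r ∉ X := fun h => hXS' r h hr
    have hX' : IsListPath G (r :: X) r c := hX.cons hadj hrX
    have hYS' : ∀ v ∈ Y, v ∈ S → v = y := fun v hv hvS => hYS v hv (.inr hvS)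
    by_cases hyr : y = r
    · subst hyr
      obtain ⟨s, hs, hsr⟩ := hS
      obtain ⟨Z, z, z', hZ, hzS, hz', hyZ, hZS, hZE⟩ :=
        exists_connecting_path (h2 y) S {v | v ∈ X ∨ v ∈ Y ∨ v ∈ T} hs hsr
          (.inl hX.head_mem) hyr₁.symm
      have hz'y : z' ≠ y := by
        rintro rfl
        exact hyZ hZ.last_mem
      by_cases hzX : z' ∈ X
      · obtain ⟨X₂, hX₂, hX₂X, -⟩ := hX.drop hzX
        obtain ⟨Q, hQ, hQm, -⟩ := hZ.glue hX₂ fun v hv hv' => hZE v hv (.inl (hX₂X v hv'))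
        refine ⟨Y, Q, z, d, c, hY, hQ, hzS, hd, hc, ?_, hYS', ?_, hYT, ?_, hcd.symm⟩ <;>
          simp only [hQm] <;> grind
      by_cases hzY : z' ∈ Y
      · obtain ⟨Y₂, hY₂, hY₂Y, hyY₂⟩ := hY.drop hzY
        obtain ⟨Q, hQ, hQm, -⟩ := hZ.glue hY₂ fun v hv hv' => hZE v hv (.inr (.inl (hY₂Y v hv')))
        refine ⟨y :: X, Q, z, c, d, hX', hQ, hzS, hc, hd, ?_, ?_, ?_, ?_, ?_, hcd⟩ <;>
          simp only [hQm, List.mem_cons] <;> grind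
      · have hz' : z' ∈ T := (hz'.resolve_left hzX).resolve_left hzY
        rcases hcd with hcd | hcd
        · exact ⟨y :: X, Z, z, c, z', hX', hZ, hzS, hc, hz', by grind, by grind, hZS, by grind,
            by grind, .inl hcd⟩
        · exact ⟨Y, Z, z, d, z', hY, hZ, hzS, hd, hz', by grind, hYS', hZS, hYT,
            by grind, .inl hcd⟩
    · exact ⟨r :: X, Y, y, c, d, hX', hY, hyS, hc, hd, by grind, by grind, hYS', by grind, hYT, hcd⟩

/-- Two vertex sets, each traversable by long paths ending in a fixed vertex, are joined
to a long cycle, presented as a path with adjacent ends. -/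
theorem exists_cycle_of_traversable {V : Type*} {G : SimpleGraph V}
    (h2 : ∀ v : V, (G.induce {w : V | w ≠ v}).Connected) {k : ℕ} {S T : Set V} {a b : V}
    {R : List V} (hR : IsListPath G R a b) (ha : a ∈ S) (hb : b ∈ T)
    (hS : ∃ s ∈ S, s ≠ a) (hT : ∃ s ∈ T, s ≠ b)
    (hRS : ∀ v ∈ R, v ∈ S → v = a) (hRT : ∀ v ∈ R, v ∈ T → v = b)
    (hST : ∀ v ∈ S, v ∈ T → v = a)
    (hSt : ∀ s ∈ S, s ≠ a → ∃ l, IsListPath G l s a ∧ (∀ v ∈ l, v ∈ S) ∧ k + 1 ≤ l.length)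
    (hTt : ∀ s ∈ T, s ≠ b → ∃ l, IsListPath G l s b ∧ (∀ v ∈ l, v ∈ T) ∧ k + 1 ≤ l.length) :
    ∃ C x y, IsListPath G C x y ∧ G.Adj y x ∧ 2 * k ≤ C.length := by
  obtain ⟨R, rfl⟩ := hR.eq_cons
  obtain ⟨e', he', hee⟩ := hT
  have hn := hR.2.2.2
  obtain ⟨X, Y, y, c, d, hX, hY, hy, hc, hd, hXY, hXS, hYS, hXT, hYT, hcd⟩ :=
    exists_two_disjoint_paths h2 T hb he' hee R a S hR
      (by
        intro v hv hvS
        have := hRS v (by simp [hv]) hvS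
        exact (List.nodup_cons.1 hn).1 (this ▸ hv)) ha hS hRT
  have hya : y ≠ a := by
    rintro rfl
    exact hXY _ hX.head_mem hY.head_mem
  have hcd' : c ≠ d := by
    rintro rfl
    exact hXY _ hX.last_mem hY.last_mem
  obtain ⟨L, hL, hLS, hLk⟩ := hSt y hy hya
  obtain ⟨M, hM, hMT, hMk⟩ : ∃ l, IsListPath G l c d ∧ (∀ v ∈ l, v ∈ T) ∧ k + 1 ≤ l.length := by
    rcases hcd with rfl | rfl
    · obtain ⟨l, h, h', h''⟩ := hTt d hd hcd'.symm
      exact ⟨l.reverse, h.reverse, by simpa using h', by simpa using h''⟩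
    · exact hTt c hc hcd'
  obtain ⟨Q, hQ, hQm, hQl⟩ := hL.glue hX fun v hv hv' => hXS v hv' (hLS v hv)
  obtain ⟨Q', hQ', hQm', hQl'⟩ := hQ.glue hM (by
    intro v hv hvM
    rcases (hQm v).1 hv with hv | hv
    · have := hST v (hLS v hv) (hMT v hvM)
      subst this
      exact hXT _ hX.head_mem (hMT _ hvM)
    · exact hXT v hv (hMT v hvM))
  have hXpos : 0 < X.length := List.length_pos_of_mem hX.head_mem
  obtain ⟨Y', rfl⟩ := hY.eq_cons
  have hyd : y ≠ d := by
    rintro rfl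
    exact hya (hST _ hy hd)
  cases Y' with
  | nil => exact absurd (by simpa using hY.2.1) hyd
  | cons y₁ Y' =>
    have hadj : G.Adj y y₁ := by have := hY.2.2.1; simp at this; exact this.1
    have hY' : IsListPath G (y₁ :: Y') y₁ d := IsListPath.of_append_right (l := [y]) hY
    have hnY := (List.nodup_cons.1 hY.2.2.2).1
    obtain ⟨C, hC, -, hCl⟩ := hQ'.glue hY'.reverse (by
      intro v hv hvY
      rw [List.mem_reverse] at hvY
      have hvY' := List.mem_cons_of_mem y hvY
      rcases (hQm' v).1 hv with hv | hv
      · rcases (hQm v).1 hv with hv | hv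
        · have := hYS v hvY' (hLS v hv)
          exact absurd (this ▸ hvY) hnY
        · exact absurd hvY' (hXY v hv)
      · exact hYT v hvY' (hMT v hv))
    refine ⟨C, y, y₁, hC, hadj.symm, ?_⟩
    simp at hCl
    omega

/-- From every vertex there is a path at least as long as a given cycle, and strictly longer
if the vertex is not on the cycle. -/
theorem exists_path_from_of_cycle {V : Type*} {G : SimpleGraph V}
    (h2 : ∀ v : V, (G.induce {w : V | w ≠ v}).Connected) {C : List V} {x y : V}
    (hC : IsListPath G C x y) (hyx : G.Adj y x) (u : V) :
    ∃ l w, IsListPath G l u w ∧ C.length ≤ l.length ∧ (u ∉ C → C.length < l.length) := by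
  by_cases hu : u ∈ C
  · obtain ⟨l, w, hl, -, hlen⟩ := hC.rotate hyx hu
    exact ⟨l, w, hl, hlen.ge, fun h => absurd hu h⟩
  · have hux : u ≠ x := fun h => hu (h ▸ hC.head_mem)
    obtain ⟨Z, a, c, hZ, ha, hc, -, -, hZC⟩ :=
      exists_connecting_path (h2 x) {u} {v | v ∈ C} rfl hux hC.last_mem hyx.ne
    obtain rfl : a = u := ha
    obtain ⟨l, w, hl, hlm, hlen⟩ := hC.rotate hyx hc
    obtain ⟨Q, hQ, -, hQl⟩ := hZ.glue hl fun v hv hv' => hZC v hv ((hlm v).1 hv')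
    have : 2 ≤ Z.length := by
      obtain ⟨Z', rfl⟩ := hZ.eq_cons
      cases Z' with
      | nil =>
        obtain rfl : a = c := by simpa using hZ.2.1
        exact absurd hc hu
      | cons _ _ => simp
    exact ⟨Q, w, hQ, by omega, fun _ => by omega⟩

theorem exists_adj_ne {V : Type*} [Fintype V] {G : SimpleGraph V} (h2 : TwoConnected G)
    {u r : V} (hur : u ≠ r) : ∃ z, G.Adj u z ∧ z ≠ r := by
  classical
  obtain ⟨s, hs⟩ : ∃ s, s ∉ ({u, r} : Finset V) := by
    by_contra! h
    have h1 := Finset.card_le_card (fun v _ => h v : (Finset.univ : Finset V) ⊆ {u, r})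
    have h3 := Finset.card_le_two (a := u) (b := r)
    have := h2.1
    rw [Finset.card_univ] at h1
    omega
  simp only [Finset.mem_insert, Finset.mem_singleton, not_or] at hs
  have : Nontrivial {w : V | w ≠ r} := ⟨⟨⟨u, hur⟩, ⟨s, hs.2⟩, by simpa using Ne.symm hs.1⟩⟩
  obtain ⟨z, hz⟩ := (h2.2 r).preconnected.exists_adj_of_nontrivial ⟨u, hur⟩
  exact ⟨z, hz, z.2⟩

/-- A longest path can be rerouted to start at a vertex different from `u`. -/
theorem exists_longest_path_start_ne {V : Type*} [Fintype V] {G : SimpleGraph V}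
    (h2 : TwoConnected G) (u : V) {P : List V} {x y : V} (hP : IsListPath G P x y)
    (hmax : ∀ l a b, IsListPath G l a b → l.length ≤ P.length) :
    ∃ P' x', IsListPath G P' x' y ∧ P'.length = P.length ∧ x' ≠ u := by
  by_cases hxu : x = u
  swap
  · exact ⟨P, x, hP, rfl, hxu⟩
  subst hxu
  obtain ⟨P, rfl⟩ := hP.eq_cons
  have hnb : ∀ z, G.Adj x z → z ∈ x :: P := by
    intro z hz
    by_contra hzP
    have := hmax _ _ _ (hP.cons hz.symm hzP)
    simp at this
  cases P with
  | nil =>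
    have := h2.1
    obtain ⟨r, hr⟩ := Fintype.exists_ne_of_one_lt_card (by omega) x
    obtain ⟨z, hz, -⟩ := exists_adj_ne h2 hr.symm
    have := hnb z hz
    simp at this
    exact absurd this hz.ne'
  | cons w P =>
    have hxw : G.Adj x w := by have := hP.2.2.1; simp at this; exact this.1
    obtain ⟨z, hz, hzw⟩ := exists_adj_ne h2 hxw.ne
    have hzP : z ∈ P := by
      have := hnb z hz
      simpa [hz.ne', hzw] using this
    obtain ⟨l₁, l₂, rfl⟩ := List.append_of_mem hzP
    have hd := hP.2.2.2
    have h1 : IsListPath G (z :: l₂) z y := IsListPath.of_append_right (l := x :: w :: l₁) hP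
    rcases List.eq_nil_or_concat (w :: l₁) with h | ⟨q, c, hq⟩
    · simp at h
    have h0 : IsListPath G (x :: (q ++ [c])) x c :=
      IsListPath.of_append_left (l := x :: q) (z := c) (m := z :: l₂) (by
        have : x :: w :: (l₁ ++ z :: l₂) = x :: ((w :: l₁) ++ z :: l₂) := by simp
        rw [this, hq] at hP
        simpa using hP)
    rw [List.concat_eq_append] at hq
    rw [← hq] at h0
    refine ⟨_, c, h0.reverse.append h1 hz ?_, by simp; omega, ?_⟩
    · intro v hv
      rw [List.mem_reverse] at hv
      have : x :: w :: (l₁ ++ z :: l₂) = (x :: w :: l₁) ++ z :: l₂ := by simp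
      rw [this, List.nodup_append] at hd
      exact fun h => hd.2.2 v hv v h rfl
    · rintro rfl
      have : c ∈ w :: l₁ := by rw [hq]; simp
      have hd' := (List.nodup_cons.1 hd).1
      simp at hd' this
      tauto

/-- The initial segment of a path up to a neighbour of its first vertex contains, from each of its
vertices, a path to that neighbour covering all neighbours of the first vertex. -/
theorem exists_path_through_neighbors {V : Type*} {G : SimpleGraph V} {p : ℕ → V} {a s : ℕ}
    (hadj : ∀ r < a, G.Adj (p r) (p (r + 1)))
    (hinj : ∀ r s, r ≤ a → s ≤ a → p r = p s → r = s)
    {A : Finset ℕ} (hA : ∀ i ∈ A, 0 < i ∧ i ≤ a ∧ G.Adj (p 0) (p i)) (haA : a ∈ A) (hs : s < a) :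
    ∃ l, IsListPath G l (p s) (p a) ∧ (∀ v ∈ l, ∃ r ≤ a, p r = v) ∧ A.card + 1 ≤ l.length := by
  obtain ⟨j, hj, hjmin⟩ := (A.filter (s < ·)).exists_min_image id ⟨a, by simp [haA, hs]⟩
  simp only [Finset.mem_filter, id] at hj hjmin
  have hja := (hA j hj.1).2.1
  obtain ⟨l₁, h1, h1l, h1m⟩ := IsListPath.exists_segment (G := G) (p := p) (Nat.zero_le s)
    (fun r _ h => hadj r (by omega)) (fun r t _ h _ h' => hinj r t (by omega) (by omega))
  obtain ⟨l₂, h2, h2l, h2m⟩ := IsListPath.exists_segment (G := G) (p := p) hja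
    (fun r _ h => hadj r (by omega)) (fun r t _ h _ h' => hinj r t (by omega) (by omega))
  refine ⟨_, h1.reverse.append h2 (hA j hj.1).2.2 ?_, ?_, ?_⟩
  · intro v hv hv'
    rw [List.mem_reverse, h1m] at hv
    rw [h2m] at hv'
    obtain ⟨r, -, hr, rfl⟩ := hv
    obtain ⟨t, ht, ht', h⟩ := hv'
    have := hinj _ _ ht' (by omega) h
    omega
  · intro v hv
    rw [List.mem_append, List.mem_reverse, h1m, h2m] at hv
    rcases hv with ⟨r, -, hr, h⟩ | ⟨r, -, hr, h⟩
    · exact ⟨r, by omega, h⟩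
    · exact ⟨r, hr, h⟩
  · have hsub : A ⊆ Finset.Icc 1 s ∪ Finset.Icc j a := by
      intro i hi
      have := hA i hi
      simp only [Finset.mem_union, Finset.mem_Icc]
      by_cases his : s < i
      · have := hjmin i ⟨hi, his⟩
        omega
      · omega
    have := (Finset.card_le_card hsub).trans (Finset.card_union_le _ _)
    simp only [Nat.card_Icc] at this
    simp only [List.length_append, List.length_reverse]
    omega

/-- A longest path whose end vertices have degree at least `k` yields a cycle on at least
`2 * k` vertices or on all vertices of the path. -/
theorem exists_cycle_of_longest_path {V : Type*} [Fintype V] {G : SimpleGraph V}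
    (h2 : TwoConnected G) {k : ℕ} (hk : 0 < k) {P : List V} {x y : V} (hP : IsListPath G P x y)
    (hmax : ∀ l a b, IsListPath G l a b → l.length ≤ P.length)
    (hx : k ≤ deg G x) (hy : k ≤ deg G y) :
    ∃ C a b, IsListPath G C a b ∧ G.Adj b a ∧ (2 * k ≤ C.length ∨ C.length = P.length) := by
  classical
  have hnx : ∀ z, G.Adj x z → z ∈ P := by
    intro z hz
    by_contra hzP
    have := hmax _ _ _ (hP.cons hz.symm hzP)
    simp at this
  have hny : ∀ z, G.Adj y z → z ∈ P := by
    intro z hz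
    by_contra hzP
    have := hmax _ _ _ (hP.reverse.cons hz.symm (by simpa using hzP))
    simp at this
  obtain ⟨t, ht⟩ : ∃ t, P.length = t + 1 :=
    ⟨P.length - 1, by have := List.length_pos_of_mem hP.head_mem; omega⟩
  obtain ⟨p, hp⟩ : ∃ p : ℕ → V, ∀ i, (h : i < P.length) → p i = P[i] :=
    ⟨fun i => P.getD i x, fun i h => by simp [h]⟩
  have hp0 : p 0 = x := by
    rw [hp 0 (by omega)]
    have := hP.1
    rw [List.head?_eq_getElem?, List.getElem?_eq_getElem (by omega)] at this
    simpa using this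
  have hpt : p t = y := by
    rw [hp t (by omega)]
    have := hP.2.1
    rw [List.getLast?_eq_getElem?, ht, List.getElem?_eq_getElem (by omega)] at this
    simpa using this
  have hadj : ∀ r < t, G.Adj (p r) (p (r + 1)) := by
    intro r hr
    rw [hp r (by omega), hp (r + 1) (by omega)]
    exact List.isChain_iff_getElem.1 hP.2.2.1 r (by omega)
  have hinj : ∀ r s, r ≤ t → s ≤ t → p r = p s → r = s := by
    intro r s hr hs h
    rw [hp r (by omega), hp s (by omega)] at h
    exact (hP.2.2.2.getElem_inj_iff).1 h
  have hmem : ∀ v ∈ P, ∃ r ≤ t, p r = v := by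
    intro v hv
    obtain ⟨i, hi, h⟩ := List.mem_iff_getElem.1 hv
    exact ⟨i, by omega, by rw [hp i hi, h]⟩
  have hcard : ∀ v, (∀ z, G.Adj v z → z ∈ P) →
      deg G v ≤ ((Finset.range (t + 1)).filter fun i => G.Adj v (p i)).card := by
    intro v hv
    rw [deg, Nat.card_coe_set_eq]
    calc (G.neighborSet v).ncard
        ≤ (((Finset.range (t + 1)).filter fun i => G.Adj v (p i)).image p : Set V).ncard := by
          refine Set.ncard_le_ncard ?_ (Set.toFinite _)
          intro z hz
          obtain ⟨r, hr, rfl⟩ := hmem z (hv z hz)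
          refine Finset.mem_coe.2 (Finset.mem_image_of_mem p ?_)
          simp only [Finset.mem_filter, Finset.mem_range]
          exact ⟨by omega, hz⟩
      _ ≤ _ := by
          rw [Set.ncard_coe_finset]
          exact Finset.card_image_le
  set A := (Finset.range (t + 1)).filter fun i => G.Adj (p 0) (p i) with hA
  set B := (Finset.range (t + 1)).filter fun i => G.Adj (p t) (p i) with hB
  have hAk : k ≤ A.card := by rw [hA, hp0]; exact hx.trans (hcard x hnx)
  have hBk : k ≤ B.card := by rw [hB, hpt]; exact hy.trans (hcard y hny)
  have hAm : ∀ i ∈ A, 0 < i ∧ i ≤ t ∧ G.Adj (p 0) (p i) := by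
    intro i hi
    simp only [hA, Finset.mem_filter, Finset.mem_range] at hi
    refine ⟨Nat.pos_of_ne_zero ?_, by omega, hi.2⟩
    rintro rfl
    exact hi.2.ne rfl
  have hBm : ∀ i ∈ B, i < t ∧ G.Adj (p t) (p i) := by
    intro i hi
    simp only [hB, Finset.mem_filter, Finset.mem_range] at hi
    refine ⟨lt_of_le_of_ne (by omega) ?_, hi.2⟩
    rintro rfl
    exact hi.2.ne rfl
  have hseg : ∀ i j, i ≤ j → j ≤ t → ∃ l, IsListPath G l (p i) (p j) ∧ l.length + i = j + 1 ∧
      ∀ v, v ∈ l ↔ ∃ r, i ≤ r ∧ r ≤ j ∧ p r = v := fun i j hij hj =>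
    IsListPath.exists_segment hij (fun r _ h => hadj r (by omega))
      (fun r s _ h _ h' => hinj r s (by omega) (by omega))
  have hAne : A.Nonempty := Finset.card_pos.1 (by omega)
  have hBne : B.Nonempty := Finset.card_pos.1 (by omega)
  by_cases hcross : ∃ q : ℕ × ℕ, q ∈ (B ×ˢ A).filter fun q => q.1 < q.2
  · obtain ⟨⟨i, j⟩, hij, hmin⟩ := Finset.exists_min_image _ (fun q => q.2 - q.1) hcross
    simp only [Finset.mem_filter, Finset.mem_product, Prod.forall] at hij hmin
    obtain ⟨⟨hi, hj⟩, hlt⟩ := hij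
    have hjt := (hAm j hj).2.1
    obtain ⟨l₁, h1, h1l, h1m⟩ := hseg 0 i (by omega) (by omega)
    obtain ⟨l₂, h2', h2l, h2m⟩ := hseg j t hjt le_rfl
    refine ⟨_, _, _, h1.append h2'.reverse (hBm i hi).2.symm ?_, (hAm j hj).2.2.symm, ?_⟩
    · intro v hv hv'
      rw [List.mem_reverse, h2m] at hv'
      rw [h1m] at hv
      obtain ⟨r, -, hr, rfl⟩ := hv
      obtain ⟨s, hs, hs', h⟩ := hv'
      have := hinj _ _ hs' (by omega) h
      omega
    · simp only [List.length_append, List.length_reverse]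
      rcases Nat.lt_or_ge (i + 1) j with hgap | hgap
      swap
      · right; omega
      left
      have hdisj : Disjoint A (B.image (· + 1)) := by
        rw [Finset.disjoint_left]
        intro a haA haB
        obtain ⟨b, hb, rfl⟩ := Finset.mem_image.1 haB
        have := hmin b (b + 1) ⟨⟨hb, haA⟩, by omega⟩
        omega
      have hsub : A ∪ B.image (· + 1) ⊆ Finset.Icc 1 (i + 1) ∪ Finset.Icc j t := by
        intro m hm
        simp only [Finset.mem_union, Finset.mem_Icc]
        rcases Finset.mem_union.1 hm with hm | hm
        · have := hAm m hm
          by_contra hcon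
          have := hmin i m ⟨⟨hi, hm⟩, by omega⟩
          omega
        · obtain ⟨b, hb, rfl⟩ := Finset.mem_image.1 hm
          have := hBm b hb
          by_contra hcon
          have := hmin b j ⟨⟨hb, hj⟩, by omega⟩
          omega
      have h3 := (Finset.card_le_card hsub).trans (Finset.card_union_le _ _)
      rw [Finset.card_union_of_disjoint hdisj,
        Finset.card_image_of_injective _ (add_left_injective 1)] at h3
      simp only [Nat.card_Icc] at h3
      omega
  · have hBA : ∀ i ∈ B, ∀ j ∈ A, j ≤ i := by
      intro i hi j hj
      by_contra! h
      exact hcross ⟨(i, j), by simp [hi, hj, h]⟩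
    obtain ⟨a, ha, hamax⟩ := A.exists_max_image id hAne
    obtain ⟨b, hb, hbmin⟩ := B.exists_min_image id hBne
    simp only [id] at hamax hbmin
    have hab := hBA b hb a ha
    have ha' := hAm a ha
    have hb' := hBm b hb
    obtain ⟨R, hR, -, hRm⟩ := hseg a b hab hb'.1.le
    obtain ⟨C, c, d, hC, hdc, hCl⟩ := exists_cycle_of_traversable h2.2 (k := k)
      (S := {v | ∃ r ≤ a, p r = v}) (T := {v | ∃ r, b ≤ r ∧ r ≤ t ∧ p r = v}) hR
      ⟨a, le_rfl, rfl⟩ ⟨b, le_rfl, hb'.1.le, rfl⟩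
      ⟨p 0, ⟨0, by omega, rfl⟩, fun h => ha'.1.ne (hinj _ _ (by omega) (by omega) h)⟩
      ⟨p t, ⟨t, hb'.1.le, le_rfl, rfl⟩, fun h => hb'.1.ne' (hinj _ _ (by omega) (by omega) h)⟩
      (by
        intro v hv hvS
        obtain ⟨r, hr, hr', rfl⟩ := (hRm v).1 hv
        obtain ⟨s, hs, h⟩ := hvS
        have := hinj _ _ (by omega) (by omega) h
        congr 1
        omega)
      (by
        intro v hv hvT
        obtain ⟨r, hr, hr', rfl⟩ := (hRm v).1 hv
        obtain ⟨s, hs, hs', h⟩ := hvT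
        have := hinj _ _ (by omega) (by omega) h
        congr 1
        omega)
      (by
        rintro v ⟨r, hr, rfl⟩ ⟨s, hs, hs', h⟩
        have := hinj _ _ (by omega) (by omega) h
        congr 1
        omega)
      (by
        rintro v ⟨s, hs, rfl⟩ hsa
        have : s ≠ a := fun h => hsa (h ▸ rfl)
        obtain ⟨l, hl, hlm, hlk⟩ := exists_path_through_neighbors (G := G) (p := p) (A := A)
          (fun r hr => hadj r (by omega)) (fun r s hr hs => hinj r s (by omega) (by omega))
          (fun i hi => ⟨(hAm i hi).1, hamax i hi, (hAm i hi).2.2⟩) ha (lt_of_le_of_ne hs this)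
        exact ⟨l, hl, hlm, by omega⟩)
      (by
        rintro v ⟨s, hs, hst, rfl⟩ hsb
        have : s ≠ b := fun h => hsb (h ▸ rfl)
        have hinjB : Set.InjOn (t - ·) (B : Set ℕ) := by
          intro i hi j hj h
          have := hBm i hi
          have := hBm j hj
          simp only at h
          omega
        obtain ⟨l, hl, hlm, hlk⟩ := exists_path_through_neighbors (G := G)
          (p := fun i => p (t - i)) (A := B.image (t - ·)) (a := t - b) (s := t - s)
          (by
            intro r hr
            have := (hadj (t - (r + 1)) (by omega)).symm
            rwa [show t - (r + 1) + 1 = t - r by omega] at this)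
          (by
            intro r s hr hs h
            have := hinj _ _ (by omega) (by omega) h
            omega)
          (by
            intro i hi
            obtain ⟨m, hm, rfl⟩ := Finset.mem_image.1 hi
            have h1 := hBm m hm
            have h2 := hbmin m hm
            refine ⟨by omega, by omega, ?_⟩
            simpa [Nat.sub_sub_self h1.1.le] using h1.2)
          (Finset.mem_image_of_mem _ hb) (by omega)
        simp only [Nat.sub_sub_self hst, Nat.sub_sub_self hb'.1.le] at hl
        rw [Finset.card_image_of_injOn hinjB] at hlk
        refine ⟨l, hl, fun v hv => ?_, by omega⟩
        obtain ⟨r, hr, h⟩ := hlm v hv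
        exact ⟨t - r, by omega, by omega, h⟩)
    exact ⟨C, c, d, hC, hdc, .inl hCl⟩

/-- Erdős–Gallai: if `G` is 2-connected and every vertex other than `u` has degree
at least `k ≥ 2`, then `G` has a path on `min{ν(G), 2k}` vertices with end vertex `u`. -/
theorem stmt_17 {V : Type*} [Fintype V] [DecidableEq V] (k : ℕ) (hk : 2 ≤ k)
    (G : SimpleGraph V) (h2 : TwoConnected G) (u : V)
    (hd : ∀ w : V, w ≠ u → k ≤ deg G w) :
    ∃ (w : V) (p : G.Walk u w), p.IsPath ∧
      p.support.length = min (Fintype.card V) (2 * k) := by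
  classical
  have hbound : ∀ l x y, IsListPath G l x y → l.length ≤ Fintype.card V :=
    fun l x y h => h.2.2.2.length_le_card
  obtain ⟨P, x, y, hP, hmax⟩ : ∃ P x y, IsListPath G P x y ∧
      ∀ l a b, IsListPath G l a b → l.length ≤ P.length := by
    have hex : ∃ n, ∃ l x y, IsListPath G l x y ∧ l.length + n = Fintype.card V := by
      refine ⟨Fintype.card V - 1, [u], u, u, .singleton G u, ?_⟩
      have := h2.1
      simp
      omega
    obtain ⟨P, x, y, hP, hn⟩ := Nat.find_spec hex
    refine ⟨P, x, y, hP, fun l a b hl => ?_⟩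
    have h1 := hbound l a b hl
    have := Nat.find_min' hex ⟨l, a, b, hl, Nat.add_sub_cancel' h1⟩
    omega
  obtain ⟨P₁, x', hP₁, hl₁, hx'⟩ := exists_longest_path_start_ne h2 u hP hmax
  obtain ⟨P₂, y', hP₂, hl₂, hy'⟩ := exists_longest_path_start_ne h2 u hP₁.reverse
    (fun l a b h => by rw [List.length_reverse, hl₁]; exact hmax l a b h)
  rw [List.length_reverse, hl₁] at hl₂
  obtain ⟨C, a, b, hC, hba, hCl⟩ := exists_cycle_of_longest_path h2 (by omega) hP₂
    (fun l a b h => by rw [hl₂]; exact hmax l a b h) (hd y' hy') (hd x' hx')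
  have hClen : min (Fintype.card V) (2 * k) ≤ C.length := by
    rcases hCl with h | h
    · omega
    · have hall : ∀ v, v ∈ C := by
        intro v
        by_contra hv
        obtain ⟨l, w, hl, -, hlt⟩ := exists_path_from_of_cycle h2.2 hC hba v
        have := hmax l v w hl
        have := hlt hv
        omega
      have : Fintype.card V ≤ C.length := by
        rw [← Finset.card_univ]
        calc (Finset.univ : Finset V).card ≤ C.toFinset.card :=
              Finset.card_le_card fun v _ => by simpa using hall v
          _ ≤ C.length := C.toFinset_card_le
      omega
  obtain ⟨l, w, hl, hle, -⟩ := exists_path_from_of_cycle h2.2 hC hba u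
  obtain ⟨p, hp⟩ := hl.exists_walk
  refine ⟨_, p.take (min (Fintype.card V) (2 * k) - 1), ?_, ?_⟩
  · exact SimpleGraph.Walk.IsPath.take (p.isPath_def.2 (hp ▸ hl.2.2.2)) _
  · have h1 := p.length_support
    rw [hp] at h1
    have := h2.1
    rw [SimpleGraph.Walk.length_support, SimpleGraph.Walk.take_length]
    omega
end
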